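/- arXiv:0902.2101 — 2 statements merged into one kernel-verified Lean document; each statement's English description precedes it below -/
import Mathlib

section
/- Suppose μ satisfies the transportation-information inequality W₁I(C), i.e. W₁(ν,μ)² ≤ 4C² I(ν|μ) for all probability measures ν on ℝⁿ. Then μ satisfies the transportation-entropy inequality W₁H(C), i.e. W₁(ν,μ)² ≤ 2C H(ν|μ) for every probability measure ν on ℝⁿ. -/
open MeasureTheory ENNReal Classical

/-- A coupling of `ν` and `μ`. -/
def IsCoupling {n : ℕ}
    (π : Measure (EuclideanSpace ℝ (Fin n) × EuclideanSpace ℝ (Fin n)))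
    (ν μ : Measure (EuclideanSpace ℝ (Fin n))) : Prop :=
  π.map Prod.fst = ν ∧ π.map Prod.snd = μ

/-- The `L^p`-Wasserstein distance for the Euclidean distance. -/
noncomputable def wassersteinDist {n : ℕ} (p : ℝ)
    (ν μ : Measure (EuclideanSpace ℝ (Fin n))) : ℝ≥0∞ :=
  (⨅ (π : Measure (EuclideanSpace ℝ (Fin n) × EuclideanSpace ℝ (Fin n)))
      (_ : IsCoupling π ν μ), ∫⁻ q, edist q.1 q.2 ^ p ∂π) ^ (1 / p)

/-- The relative entropy (Kullback information) `H(ν|μ)`. -/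

noncomputable def relEntropy {n : ℕ}
    (ν μ : Measure (EuclideanSpace ℝ (Fin n))) : ℝ≥0∞ :=
  if ν ≪ μ ∧ Integrable (llr ν μ) ν then ENNReal.ofReal (∫ x, llr ν μ x ∂ν) else ⊤

/-- The Fisher information `I(ν|μ) = ∫ |∇√f|² dμ` for `ν = fμ` with `√f ∈ H¹(μ)`,
and `+∞` otherwise. -/
noncomputable def fisherInfo {n : ℕ}
    (ν μ : Measure (EuclideanSpace ℝ (Fin n))) : ℝ≥0∞ :=
  ⨅ (f : EuclideanSpace ℝ (Fin n) → ℝ) (_ : ∀ x, 0 ≤ f x)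
    (_ : ν = μ.withDensity fun x => ENNReal.ofReal (f x))
    (_ : Differentiable ℝ fun x => Real.sqrt (f x)),
    ∫⁻ x, (‖gradient (fun y => Real.sqrt (f y)) x‖₊ : ℝ≥0∞) ^ 2 ∂μ

/-- Kantorovich duality for finitely supported measures. -/
theorem exists_transport_plan_le {ι : Type*} [Fintype ι] (c : ι → ι → ℝ) (a b : ι → ℝ)
    (ha : ∀ i, 0 ≤ a i) (hb : ∀ i, 0 ≤ b i) (ha1 : ∑ i, a i = 1) (hb1 : ∑ i, b i = 1) (S : ℝ)
    (h : ∀ φ ψ : ι → ℝ, (∀ i j, φ i + ψ j ≤ c i j) → ∑ i, a i * φ i + ∑ j, b j * ψ j ≤ S) :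
    ∃ p : ι → ι → ℝ, (∀ i j, 0 ≤ p i j) ∧ (∀ i, ∑ j, p i j = a i) ∧ (∀ j, ∑ i, p i j = b j) ∧
      ∑ i, ∑ j, p i j * c i j ≤ S := by
  let L : (ι × ι → ℝ) →ₗ[ℝ] (ι → ℝ) × (ι → ℝ) × ℝ :=
    { toFun := fun p => (fun i => ∑ j, p (i, j), fun j => ∑ i, p (i, j),
        ∑ i, ∑ j, p (i, j) * c i j)
      map_add' := fun p q => by
        simp only [Pi.add_apply, Finset.sum_add_distrib, add_mul]
        rfl
      map_smul' := fun t p => by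
        simp only [Pi.smul_apply, smul_eq_mul, mul_assoc, ← Finset.mul_sum, RingHom.id_apply]
        rfl }
  by_cases hdisj : Disjoint (L '' stdSimplex ℝ (ι × ι)) ({a} ×ˢ {b} ×ˢ Set.Iic S)
  · exfalso
    obtain ⟨f, u, v, hu, huv, hv⟩ := geometric_hahn_banach_compact_closed
      ((convex_stdSimplex ℝ (ι × ι)).linear_image L)
      ((isCompact_stdSimplex ℝ (ι × ι)).image L.continuous_of_finiteDimensional)
      ((convex_singleton a).prod ((convex_singleton b).prod (convex_Iic S)))
      (isClosed_singleton.prod (isClosed_singleton.prod isClosed_Iic)) hdisj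
    set φ : ι → ℝ := fun i => f (Pi.single i 1, 0, 0) with hφ
    set ψ : ι → ℝ := fun i => f (0, Pi.single i 1, 0) with hψ
    set s : ℝ := f (0, 0, 1) with hs
    have hsingle (i : ι) : (fun j => if i = j then (1 : ℝ) else 0) = Pi.single i 1 := by
      ext j; simp [Pi.single_apply, eq_comm]
    have hf (x y : ι → ℝ) (r : ℝ) : f (x, y, r) = ∑ i, x i * φ i + ∑ i, y i * ψ i + r * s := by
      have h1 : f (x, 0, 0) = ∑ i, x i * φ i := by
        have := LinearMap.pi_apply_eq_sum_univ
          (f.toLinearMap ∘ₗ LinearMap.inl ℝ (ι → ℝ) ((ι → ℝ) × ℝ)) x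
        simp only [hsingle] at this
        exact this
      have h2 : f (0, y, 0) = ∑ i, y i * ψ i := by
        have := LinearMap.pi_apply_eq_sum_univ
          (f.toLinearMap ∘ₗ LinearMap.inr ℝ (ι → ℝ) ((ι → ℝ) × ℝ) ∘ₗ
            LinearMap.inl ℝ (ι → ℝ) ℝ) y
        simpa [hsingle, hψ] using this
      have h3 : f (0, 0, r) = r * s := by
        rw [hs, ← smul_eq_mul, ← map_smul]; simp
      rw [← h1, ← h2, ← h3, ← map_add, ← map_add]; simp
    have hT (i j : ι) : φ i + ψ j + c i j * s < u := by
      have := hu _ ⟨_, single_mem_stdSimplex ℝ (i, j), rfl⟩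
      have hL : L (Pi.single (i, j) 1) = (Pi.single i 1, Pi.single j 1, c i j) := by
        simp only [L, LinearMap.coe_mk, AddHom.coe_mk, Prod.mk.injEq]
        refine ⟨?_, ?_, ?_⟩
        · ext k; by_cases hk : k = i <;> simp [Pi.single_apply, hk]
        · ext k; by_cases hk : k = j <;> simp [Pi.single_apply, hk]
        · simp [Pi.single_apply, ite_and, Prod.mk.injEq]
      rw [hL, hf] at this
      simpa [Pi.single_apply] using this
    have hD (r : ℝ) (hr : r ≤ S) : v < ∑ i, a i * φ i + ∑ i, b i * ψ i + r * s := by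
      rw [← hf]; exact hv _ ⟨rfl, rfl, hr⟩
    set m := ∑ i, a i * φ i + ∑ i, b i * ψ i with hm
    have hs0 : s ≤ 0 := by
      by_contra! hs0
      have h1 := hD (min S ((v - m) / s)) (min_le_left _ _)
      have h2 := mul_le_mul_of_nonneg_right (min_le_right S ((v - m) / s)) hs0.le
      rw [div_mul_cancel₀ _ hs0.ne'] at h2
      linarith
    rcases hs0.eq_or_lt with hs0 | hs0
    · have h1 : ∑ i, ∑ j, a i * b j * (φ i + ψ j) ≤ ∑ i, ∑ j, a i * b j * u := by
        gcongr with i _ j _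
        · exact mul_nonneg (ha i) (hb j)
        · have := hT i j
          rw [hs0] at this; linarith
      have h2 : ∑ i, ∑ j, a i * b j * u = u := by
        simp_rw [← Finset.sum_mul, ← Finset.mul_sum, ← Finset.sum_mul, ha1, hb1]; ring
      have h3 : ∑ i, ∑ j, a i * b j * (φ i + ψ j) = m := by
        have e1 : ∑ i, ∑ j, a i * b j * φ i = ∑ i, a i * φ i := by
          refine Finset.sum_congr rfl fun i _ => ?_
          rw [← Finset.sum_mul, ← Finset.mul_sum, hb1, mul_one]
        have e2 : ∑ i, ∑ j, a i * b j * ψ j = ∑ i, b i * ψ i := by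
          simp_rw [mul_assoc, ← Finset.mul_sum, ← Finset.sum_mul, ha1, one_mul]
        simp_rw [mul_add, Finset.sum_add_distrib, e1, e2]; rfl
      have h4 := hD S le_rfl
      rw [hs0] at h4
      linarith
    · have h1 := h (fun i => (φ i - u) / (-s)) (fun i => ψ i / (-s)) fun i j => by
        rw [← add_div, div_le_iff₀ (by linarith)]
        have := hT i j
        linarith
      have h2 : ∑ i, a i * ((φ i - u) / (-s)) + ∑ j, b j * (ψ j / (-s)) = (m - u) / (-s) := by
        simp_rw [mul_div_assoc', ← Finset.sum_div, mul_sub, Finset.sum_sub_distrib,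
          ← Finset.sum_mul, ha1, hm]
        ring
      rw [h2, div_le_iff₀ (by linarith)] at h1
      have := hD S le_rfl
      linarith
  · obtain ⟨_, ⟨p, hp, rfl⟩, h1, h2, h3⟩ := Set.not_disjoint_iff.1 hdisj
    exact ⟨fun i j => p (i, j), fun i j => hp.1 _, fun i => congrFun h1 i,
      fun j => congrFun h2 j, h3⟩

/-- A transport plan between the images of `ν` and `μ` in a finite type lifts to a coupling. -/
theorem exists_measure_lift_transport_plan {α ι : Type*} [MeasurableSpace α] [Fintype ι]
    [MeasurableSpace ι] [MeasurableSingletonClass ι] (ν μ : Measure α) [IsFiniteMeasure ν]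
    [IsFiniteMeasure μ] {s : α → ι} (hs : Measurable s) (p : ι → ι → ℝ≥0∞)
    (hp : ∀ i, ∑ j, p i j = ν (s ⁻¹' {i})) (hq : ∀ j, ∑ i, p i j = μ (s ⁻¹' {j})) :
    ∃ π : Measure (α × α), π.map Prod.fst = ν ∧ π.map Prod.snd = μ ∧
      ∀ F : ι → ι → ℝ≥0∞, ∫⁻ q, F (s q.1) (s q.2) ∂π = ∑ i, ∑ j, p i j * F i j := by
  have hsi (i : ι) : MeasurableSet (s ⁻¹' {i}) := hs (measurableSet_singleton i)
  have hν0 (i j : ι) (h : ν (s ⁻¹' {i}) = 0) : p i j = 0 :=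
    (Finset.sum_eq_zero_iff.1 ((hp i).trans h)) j (Finset.mem_univ j)
  have hμ0 (i j : ι) (h : μ (s ⁻¹' {j}) = 0) : p i j = 0 :=
    (Finset.sum_eq_zero_iff.1 ((hq j).trans h)) i (Finset.mem_univ i)
  have hsum (m : Measure α) [IsFiniteMeasure m] :
      ∑ i, m (s ⁻¹' {i}) • ProbabilityTheory.cond m (s ⁻¹' {i}) = m := by
    ext t ht
    have h1 (i : ι) : (m (s ⁻¹' {i}) • ProbabilityTheory.cond m (s ⁻¹' {i})) t
        = m (t ∩ s ⁻¹' {i}) := by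
      rw [Measure.smul_apply, smul_eq_mul, mul_comm, ProbabilityTheory.cond_mul_eq_inter (hsi i),
        Set.inter_comm]
    rw [Measure.finsetSum_apply]
    simp_rw [h1]
    rw [← measure_biUnion_finset]
    · congr 1; ext x; simp
    · intro i _ j _ hij
      refine Set.disjoint_left.2 fun x hx hx' => hij ?_
      exact hx.2.symm.trans hx'.2
    · exact fun i _ => ht.inter (hsi i)
  refine ⟨∑ i, ∑ j, p i j • (ProbabilityTheory.cond ν (s ⁻¹' {i})).prod
    (ProbabilityTheory.cond μ (s ⁻¹' {j})), ?_, ?_, fun F => ?_⟩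
  · rw [Measure.map_finset_sum' measurable_fst.aemeasurable]
    simp_rw [Measure.map_finset_sum' measurable_fst.aemeasurable, Measure.map_smul,
      Measure.map_fst_prod]
    conv_rhs => rw [← hsum ν]
    refine Finset.sum_congr rfl fun i _ => ?_
    rw [← hp, Finset.sum_smul]
    refine Finset.sum_congr rfl fun j _ => ?_
    by_cases h0 : μ (s ⁻¹' {j}) = 0
    · simp [hμ0 i j h0]
    · have := ProbabilityTheory.cond_isProbabilityMeasure h0
      simp
  · rw [Measure.map_finset_sum' measurable_snd.aemeasurable]
    simp_rw [Measure.map_finset_sum' measurable_snd.aemeasurable, Measure.map_smul,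
      Measure.map_snd_prod]
    conv_rhs => rw [← hsum μ]
    rw [Finset.sum_comm]
    refine Finset.sum_congr rfl fun j _ => ?_
    rw [← hq, Finset.sum_smul]
    refine Finset.sum_congr rfl fun i _ => ?_
    by_cases h0 : ν (s ⁻¹' {i}) = 0
    · simp [hν0 i j h0]
    · have := ProbabilityTheory.cond_isProbabilityMeasure h0
      simp
  · rw [lintegral_finsetSum_measure]
    refine Finset.sum_congr rfl fun i _ => ?_
    rw [lintegral_finsetSum_measure]
    refine Finset.sum_congr rfl fun j _ => ?_
    rw [lintegral_smul_measure, smul_eq_mul]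
    by_cases h0 : ν (s ⁻¹' {i}) = 0
    · simp [hν0 i j h0]
    by_cases h1 : μ (s ⁻¹' {j}) = 0
    · simp [hμ0 i j h1]
    have := ProbabilityTheory.cond_isProbabilityMeasure h0
    have := ProbabilityTheory.cond_isProbabilityMeasure h1
    congr 1
    have e1 : ∀ᵐ q ∂(ProbabilityTheory.cond ν (s ⁻¹' {i})).prod
        (ProbabilityTheory.cond μ (s ⁻¹' {j})), F (s q.1) (s q.2) = F i j := by
      have a1 := Measure.quasiMeasurePreserving_fst
        (μ := ProbabilityTheory.cond ν (s ⁻¹' {i})) (ν := ProbabilityTheory.cond μ (s ⁻¹' {j}))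
        |>.ae (ProbabilityTheory.ae_cond_mem (hsi i))
      have a2 := Measure.quasiMeasurePreserving_snd
        (μ := ProbabilityTheory.cond ν (s ⁻¹' {i})) (ν := ProbabilityTheory.cond μ (s ⁻¹' {j}))
        |>.ae (ProbabilityTheory.ae_cond_mem (hsi j))
      filter_upwards [a1, a2] with q h1 h2
      rw [Set.mem_singleton_iff.1 h1, Set.mem_singleton_iff.1 h2]
    rw [lintegral_congr_ae e1]; simp

/-- Lipschitz functions are uniform limits of smooth functions with the same Lipschitz constant. -/
theorem LipschitzWith.exists_differentiable_dist_le {E : Type*} [NormedAddCommGroup E]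
    [InnerProductSpace ℝ E] [FiniteDimensional ℝ E] [MeasurableSpace E] [BorelSpace E] {g : E → ℝ}
    {K : NNReal} (hg : LipschitzWith K g) {δ : ℝ} (hδ : 0 < δ) :
    ∃ h : E → ℝ, Differentiable ℝ h ∧ LipschitzWith K h ∧ ∀ x, |h x - g x| ≤ δ := by
  have hr : 0 < δ / (K + 1) := by positivity
  let φ : ContDiffBump (0 : E) := ⟨δ / (K + 1) / 2, δ / (K + 1), by positivity, by linarith⟩
  set h := convolution (φ.normed volume) g (ContinuousLinearMap.lsmul ℝ ℝ) volume with hh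
  have hex := HasCompactSupport.convolutionExists_left (ContinuousLinearMap.lsmul ℝ ℝ)
    (φ.hasCompactSupport_normed (μ := volume)) φ.continuous_normed
    (hg.continuous.locallyIntegrable (μ := volume))
  refine ⟨h, ?_, ?_, fun x => ?_⟩
  · exact (φ.hasCompactSupport_normed.contDiff_convolution_left (n := 1) _ φ.contDiff_normed
      hg.continuous.locallyIntegrable).differentiable one_ne_zero
  · refine LipschitzWith.of_le_add_mul K fun x y => ?_
    have h1 : ∫ t, φ.normed volume t * (K * dist x y) = K * dist x y := by
      rw [integral_mul_const, φ.integral_normed, one_mul]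
    rw [← h1, hh, convolution, convolution, ← integral_add (hex y) (φ.integrable_normed.mul_const _)]
    refine integral_mono (hex x) ((hex y).add (φ.integrable_normed.mul_const _)) fun t => ?_
    simp only [ContinuousLinearMap.lsmul_apply, smul_eq_mul, ← mul_add]
    refine mul_le_mul_of_nonneg_left ?_ (φ.nonneg_normed t)
    have := (le_abs_self _).trans (hg.dist_le_mul (x - t) (y - t))
    rw [dist_sub_right] at this
    linarith
  · refine φ.dist_normed_convolution_le hg.continuous.aestronglyMeasurable fun y hy => ?_
    refine (hg.dist_le_mul y x).trans ?_
    have h1 : dist y x ≤ δ / (K + 1) := (Metric.mem_ball.1 hy).le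
    calc (K : ℝ) * dist y x ≤ (K + 1) * (δ / (K + 1)) := by gcongr; linarith
      _ = δ := by field_simp

theorem wassersteinDist_one {n : ℕ} (ν μ : Measure (EuclideanSpace ℝ (Fin n))) :
    wassersteinDist 1 ν μ =
      ⨅ (π : Measure (EuclideanSpace ℝ (Fin n) × EuclideanSpace ℝ (Fin n)))
        (_ : IsCoupling π ν μ), ∫⁻ q, edist q.1 q.2 ∂π := by
  simp [wassersteinDist]

/-- The easy half of Kantorovich–Rubinstein duality. -/
theorem ofReal_integral_sub_le_wassersteinDist {n : ℕ} {ν μ : Measure (EuclideanSpace ℝ (Fin n))}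
    {g : EuclideanSpace ℝ (Fin n) → ℝ} (hg : LipschitzWith 1 g) (hν : Integrable g ν)
    (hμ : Integrable g μ) :
    ENNReal.ofReal (∫ x, g x ∂ν - ∫ x, g x ∂μ) ≤ wassersteinDist 1 ν μ := by
  rw [wassersteinDist_one]
  refine le_iInf₂ fun π hπ => ?_
  obtain ⟨rfl, rfl⟩ := hπ
  have i1 : Integrable (fun q => g q.1) π := hν.comp_measurable measurable_fst
  have i2 : Integrable (fun q => g q.2) π := hμ.comp_measurable measurable_snd
  rw [integral_map measurable_fst.aemeasurable hν.1, integral_map measurable_snd.aemeasurable hμ.1,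
    ← integral_sub i1 i2]
  refine (ENNReal.ofReal_le_ofReal (le_abs_self _)).trans ?_
  rw [← Real.norm_eq_abs, ofReal_norm]
  refine (enorm_integral_le_lintegral_enorm _).trans (lintegral_mono fun q => ?_)
  rw [← edist_eq_enorm_sub]
  simpa using hg q.1 q.2

/-- Simple functions approximate the identity in `L¹` simultaneously for two measures. -/
theorem exists_simpleFunc_lintegral_edist_lt {E : Type*} [NormedAddCommGroup E]
    [MeasurableSpace E] [BorelSpace E] [SecondCountableTopology E] {ν μ : Measure E}
    (hν : ∫⁻ x, ‖x‖ₑ ∂ν ≠ ⊤) (hμ : ∫⁻ x, ‖x‖ₑ ∂μ ≠ ⊤) {ε : ℝ≥0∞} (hε : 0 < ε) :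
    ∃ f : SimpleFunc E E, ∫⁻ x, edist (f x) x ∂ν < ε ∧ ∫⁻ x, edist (f x) x ∂μ < ε := by
  have key (m : Measure E) (hm : ∫⁻ x, ‖x‖ₑ ∂m ≠ ⊤) :=
    SimpleFunc.tendsto_approxOn_L1_enorm (f := id) measurable_id (s := Set.univ) (y₀ := (0 : E))
      (Set.mem_univ _) (μ := m) (by simp) (by simpa [HasFiniteIntegral, lt_top_iff_ne_top] using hm)
  obtain ⟨k, h1, h2⟩ := (((key ν hν).eventually_lt_const hε).and
    ((key μ hμ).eventually_lt_const hε)).exists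
  simp only [id, ← edist_eq_enorm_sub] at h1 h2
  exact ⟨_, h1, h2⟩

/-- The hard half of Kantorovich–Rubinstein duality, for measures with finite first moment. -/
theorem wassersteinDist_one_le_of_forall_lipschitz {n : ℕ}
    {ν μ : Measure (EuclideanSpace ℝ (Fin n))} [IsProbabilityMeasure ν] [IsProbabilityMeasure μ]
    (hν : ∫⁻ x, ‖x‖ₑ ∂ν ≠ ⊤) (hμ : ∫⁻ x, ‖x‖ₑ ∂μ ≠ ⊤) {S : ℝ} (hS : 0 ≤ S)
    (h : ∀ g : EuclideanSpace ℝ (Fin n) → ℝ, LipschitzWith 1 g → (∃ M, ∀ x, |g x| ≤ M) →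
      ∫ x, g x ∂ν - ∫ x, g x ∂μ ≤ S) :
    wassersteinDist 1 ν μ ≤ ENNReal.ofReal S := by
  refine ENNReal.le_of_forall_pos_le_add fun ε hε _ => ?_
  obtain ⟨f, hfν, hfμ⟩ := exists_simpleFunc_lintegral_edist_lt hν hμ
    (ε := ENNReal.ofReal (ε / 4)) (by simpa using hε)
  let s : EuclideanSpace ℝ (Fin n) → f.range := fun x => ⟨f x, f.mem_range_self x⟩
  have hs : Measurable s := f.measurable.subtype_mk
  have hne : Nonempty f.range := ⟨s 0⟩
  have hsum (m : Measure (EuclideanSpace ℝ (Fin n))) [IsProbabilityMeasure m] (φ : f.range → ℝ) :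
      ∑ i, m.real (s ⁻¹' {i}) * φ i = ∫ x, φ (s x) ∂m := by
    have := Measure.isProbabilityMeasure_map (μ := m) hs.aemeasurable
    rw [← integral_map (φ := s) (f := φ) hs.aemeasurable (by fun_prop),
      integral_fintype (Integrable.of_finite)]
    refine Finset.sum_congr rfl fun i _ => ?_
    rw [map_measureReal_apply hs (measurableSet_singleton i), smul_eq_mul]
  have hone (m : Measure (EuclideanSpace ℝ (Fin n))) [IsProbabilityMeasure m] :
      ∑ i, m.real (s ⁻¹' {i}) = 1 := by
    simpa using hsum m 1
  have hdual (φ ψ : f.range → ℝ)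
      (hφψ : ∀ i j : f.range, φ i + ψ j ≤ dist (i : EuclideanSpace ℝ (Fin n)) j) :
      ∑ i, ν.real (s ⁻¹' {i}) * φ i + ∑ i, μ.real (s ⁻¹' {i}) * ψ i ≤ S + ε / 2 := by
    let g₀ : EuclideanSpace ℝ (Fin n) → ℝ := fun x =>
      Finset.univ.inf' Finset.univ_nonempty fun j : f.range => dist x j - ψ j
    have hg₀ : LipschitzWith 1 g₀ := by
      refine LipschitzWith.of_le_add fun x y => ?_
      obtain ⟨j, -, hj⟩ := Finset.exists_mem_eq_inf' Finset.univ_nonempty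
        fun j : f.range => dist y j - ψ j
      have h1 : g₀ x ≤ dist x j - ψ j := Finset.inf'_le _ (Finset.mem_univ j)
      have h2 : g₀ y = dist y j - ψ j := hj
      linarith [dist_triangle x y j]
    have hφ (i : f.range) : φ i ≤ g₀ i :=
      (Finset.le_inf'_iff _ _).2 fun j _ => by linarith [hφψ i j]
    have hψ (j : f.range) : ψ j ≤ -g₀ j := by
      have : g₀ j ≤ dist (j : EuclideanSpace ℝ (Fin n)) j - ψ j :=
        Finset.inf'_le _ (Finset.mem_univ j)
      rw [dist_self] at this; linarith
    let M : ℝ := ∑ i : f.range, |g₀ i|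
    have hM (i : f.range) : |g₀ i| ≤ M :=
      Finset.single_le_sum (f := fun i : f.range => |g₀ i|) (fun i _ => abs_nonneg _)
        (Finset.mem_univ i)
    have hM0 : 0 ≤ M := Finset.sum_nonneg fun i _ => abs_nonneg _
    let g : EuclideanSpace ℝ (Fin n) → ℝ := fun x => max (-M) (min M (g₀ x))
    have hg : LipschitzWith 1 g := (hg₀.const_min M).const_max (-M)
    have hgM (x : EuclideanSpace ℝ (Fin n)) : |g x| ≤ M :=
      abs_le.2 ⟨le_max_left _ _, max_le (by linarith) (min_le_left _ _)⟩
    have hgr (i : f.range) : g i = g₀ i := by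
      have := abs_le.1 (hM i)
      simp only [g]
      rw [min_eq_right this.2, max_eq_right this.1]
    have hint (m : Measure (EuclideanSpace ℝ (Fin n))) [IsProbabilityMeasure m] :
        Integrable g m ∧ Integrable (fun x => g (f x)) m := by
      refine ⟨Integrable.of_bound (C := M) hg.continuous.aestronglyMeasurable (.of_forall hgM),
        Integrable.of_bound (C := M) ?_ (.of_forall fun x => hgM (f x))⟩
      exact (hg.continuous.measurable.comp f.measurable).aestronglyMeasurable
    have hclose (m : Measure (EuclideanSpace ℝ (Fin n))) [IsProbabilityMeasure m]
        (hm : ∫⁻ x, edist (f x) x ∂m < ENNReal.ofReal (ε / 4)) :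
        |∫ x, g (f x) ∂m - ∫ x, g x ∂m| ≤ ε / 4 := by
      rw [← integral_sub (hint m).2 (hint m).1, ← Real.norm_eq_abs]
      rw [← ENNReal.ofReal_le_ofReal_iff (by positivity), ofReal_norm]
      refine (enorm_integral_le_lintegral_enorm _).trans
        (le_trans (lintegral_mono fun x => ?_) hm.le)
      rw [← edist_eq_enorm_sub]
      simpa using hg (f x) x
    have h1 := abs_le.1 (hclose ν hfν)
    have h2 := abs_le.1 (hclose μ hfμ)
    have h3 := h g hg ⟨M, hgM⟩
    have h4 : ∑ i, ν.real (s ⁻¹' {i}) * φ i ≤ ∫ x, g (f x) ∂ν := by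
      refine le_trans (Finset.sum_le_sum fun i _ =>
        mul_le_mul_of_nonneg_left ((hφ i).trans (hgr i).ge) measureReal_nonneg) (hsum ν _).le
    have h5 : ∑ i, μ.real (s ⁻¹' {i}) * ψ i ≤ -∫ x, g (f x) ∂μ := by
      rw [← integral_neg]
      refine le_trans (Finset.sum_le_sum fun i _ => mul_le_mul_of_nonneg_left
        ((hψ i).trans (neg_le_neg (hgr i).le)) measureReal_nonneg) (hsum μ fun i => -g i).le
    linarith
  obtain ⟨p, hp0, hpν, hpμ, hpc⟩ := exists_transport_plan_le
    (fun i j : f.range => dist (i : EuclideanSpace ℝ (Fin n)) j)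
    (fun i => ν.real (s ⁻¹' {i})) (fun i => μ.real (s ⁻¹' {i}))
    (fun i => measureReal_nonneg) (fun i => measureReal_nonneg) (hone ν) (hone μ) (S + ε / 2) hdual
  obtain ⟨π, hπ1, hπ2, hπ⟩ := exists_measure_lift_transport_plan ν μ hs
    (fun i j => ENNReal.ofReal (p i j))
    (fun i => by
      rw [← ENNReal.ofReal_sum_of_nonneg fun j _ => hp0 i j, hpν]; simp)
    (fun j => by
      rw [← ENNReal.ofReal_sum_of_nonneg fun i _ => hp0 i j, hpμ]; simp)
  rw [wassersteinDist_one]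
  refine (iInf₂_le π ⟨hπ1, hπ2⟩).trans ?_
  have hmid : ∫⁻ q, edist (f q.1) (f q.2) ∂π ≤ ENNReal.ofReal (S + ε / 2) := by
    have := hπ fun i j => edist (i : EuclideanSpace ℝ (Fin n)) j
    refine this.le.trans ?_
    refine le_trans (le_of_eq ?_) (ENNReal.ofReal_le_ofReal hpc)
    rw [ENNReal.ofReal_sum_of_nonneg fun i _ => Finset.sum_nonneg fun j _ =>
      mul_nonneg (hp0 i j) dist_nonneg]
    refine Finset.sum_congr rfl fun i _ => ?_
    rw [ENNReal.ofReal_sum_of_nonneg fun j _ => mul_nonneg (hp0 i j) dist_nonneg]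
    refine Finset.sum_congr rfl fun j _ => ?_
    rw [ENNReal.ofReal_mul (hp0 i j), edist_dist]
  have hm : Measurable fun x => edist (f x) x := f.measurable.edist measurable_id
  have hl : ∫⁻ q, edist (f q.1) q.1 ∂π ≤ ENNReal.ofReal (ε / 4) := by
    rw [← hπ1, lintegral_map hm measurable_fst] at hfν
    exact hfν.le
  have hr : ∫⁻ q, edist (f q.2) q.2 ∂π ≤ ENNReal.ofReal (ε / 4) := by
    rw [← hπ2, lintegral_map hm measurable_snd] at hfμ
    exact hfμ.le
  calc ∫⁻ q, edist q.1 q.2 ∂π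
      ≤ ∫⁻ q, (edist (f q.1) q.1 + edist (f q.1) (f q.2) + edist (f q.2) q.2) ∂π :=
        lintegral_mono fun q => by
          rw [edist_comm (f q.1) q.1]
          exact edist_triangle4 _ _ _ _
    _ = ∫⁻ q, edist (f q.1) q.1 ∂π + ∫⁻ q, edist (f q.1) (f q.2) ∂π
          + ∫⁻ q, edist (f q.2) q.2 ∂π := by
        have hm1 : Measurable fun q : _ × EuclideanSpace ℝ (Fin n) => edist (f q.1) q.1 :=
          hm.comp measurable_fst
        have hm2 : Measurable fun q : EuclideanSpace ℝ (Fin n) × _ => edist (f q.2) q.2 :=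
          hm.comp measurable_snd
        rw [lintegral_add_right _ hm2, lintegral_add_left hm1]
    _ ≤ ENNReal.ofReal (ε / 4) + ENNReal.ofReal (S + ε / 2) + ENNReal.ofReal (ε / 4) := by
        gcongr
    _ = ENNReal.ofReal S + ε := by
        rw [← ENNReal.ofReal_coe_nnreal, ← ENNReal.ofReal_add (by positivity) (by positivity),
          ← ENNReal.ofReal_add (by positivity) (by positivity),
          ← ENNReal.ofReal_add (by positivity) (by positivity)]
        congr 1; ring

theorem fisherInfo_tilted_le {n : ℕ} {μ : Measure (EuclideanSpace ℝ (Fin n))}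
    [IsProbabilityMeasure μ] {g : EuclideanSpace ℝ (Fin n) → ℝ} (hgd : Differentiable ℝ g)
    (hg : LipschitzWith 1 g) {t : ℝ} (hint : Integrable (fun x => Real.exp (t * g x)) μ) :
    fisherInfo (μ.tilted fun x => t * g x) μ ≤ ENNReal.ofReal (t ^ 2 / 4) := by
  have hprob := isProbabilityMeasure_tilted hint
  set m := ∫ x, Real.exp (t * g x) ∂μ with hm
  have hm0 : 0 < m := integral_exp_pos hint
  have hsqrt : (fun x => √(Real.exp (t * g x) / m)) =
      fun x => Real.exp (t / 2 * g x) * (√m)⁻¹ := by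
    ext x
    rw [Real.sqrt_div (Real.exp_nonneg _), ← Real.exp_half, div_eq_mul_inv]
    congr 2; ring
  have hderiv (x : EuclideanSpace ℝ (Fin n)) :=
    (((hgd x).hasFDerivAt.const_mul (t / 2)).exp).mul_const (√m)⁻¹
  unfold fisherInfo
  refine iInf_le_of_le (fun x => Real.exp (t * g x) / m) <| iInf_le_of_le
    (fun x => by positivity) <| iInf_le_of_le rfl <| iInf_le_of_le
    (by rw [hsqrt]; exact fun x => (hderiv x).differentiableAt) ?_
  have hbound (x : EuclideanSpace ℝ (Fin n)) :
      (‖gradient (fun y => √(Real.exp (t * g y) / m)) x‖₊ : ℝ≥0∞) ^ 2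
        ≤ ENNReal.ofReal (t ^ 2 / 4) * ENNReal.ofReal (Real.exp (t * g x) / m) := by
    have h1 : ‖gradient (fun y => √(Real.exp (t * g y) / m)) x‖
        ≤ |t| / 2 * √(Real.exp (t * g x) / m) := by
      rw [gradient, LinearIsometryEquiv.norm_map, congrFun hsqrt x, hsqrt, (hderiv x).fderiv]
      simp only [norm_smul, Real.norm_eq_abs, abs_inv, abs_div, abs_two, Real.abs_exp,
        abs_of_nonneg (Real.sqrt_nonneg m)]
      have := norm_fderiv_le_of_lipschitz ℝ hg (x₀ := x)
      rw [NNReal.coe_one] at this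
      calc (√m)⁻¹ * (Real.exp (t / 2 * g x) * (|t| / 2 * ‖fderiv ℝ g x‖))
          ≤ (√m)⁻¹ * (Real.exp (t / 2 * g x) * (|t| / 2 * 1)) := by gcongr
        _ = _ := by ring
    rw [← enorm_eq_nnnorm, ← ofReal_norm, ← ENNReal.ofReal_pow (norm_nonneg _),
      ← ENNReal.ofReal_mul (by positivity)]
    refine ENNReal.ofReal_le_ofReal ((pow_le_pow_left₀ (norm_nonneg _) h1 2).trans_eq ?_)
    rw [mul_pow, Real.sq_sqrt (by positivity), div_pow, sq_abs]
    norm_num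
  refine (lintegral_mono hbound).trans ?_
  rw [lintegral_const_mul' _ _ ENNReal.ofReal_ne_top]
  have hmass : ∫⁻ x, ENNReal.ofReal (Real.exp (t * g x) / m) ∂μ = 1 := by
    have := hprob.measure_univ
    rwa [tilted_apply' _ _ MeasurableSet.univ, Measure.restrict_univ] at this
  rw [hmass, mul_one]

section TransportInformation

variable {n : ℕ} {μ : Measure (EuclideanSpace ℝ (Fin n))} [IsProbabilityMeasure μ] {C : ℝ}

theorem wassersteinDist_tilted_le (hC : 0 < C)
    (hW : ∀ ν : Measure (EuclideanSpace ℝ (Fin n)), IsProbabilityMeasure ν →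
      wassersteinDist 1 ν μ ^ 2 ≤ ENNReal.ofReal (4 * C ^ 2) * fisherInfo ν μ)
    {g : EuclideanSpace ℝ (Fin n) → ℝ} (hgd : Differentiable ℝ g) (hg : LipschitzWith 1 g) {t : ℝ}
    (hint : Integrable (fun x => Real.exp (t * g x)) μ) :
    wassersteinDist 1 (μ.tilted fun x => t * g x) μ ≤ ENNReal.ofReal (C * |t|) := by
  refine (ENNReal.pow_le_pow_left_iff two_ne_zero).1 ?_
  refine (hW _ (isProbabilityMeasure_tilted hint)).trans ?_
  refine (mul_le_mul_right (fisherInfo_tilted_le hgd hg hint) _).trans_eq ?_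
  rw [← ENNReal.ofReal_mul (by positivity), ← ENNReal.ofReal_pow (by positivity), mul_pow, sq_abs]
  congr 1; ring

theorem cgf_le_of_transport_information (hC : 0 < C)
    (hW : ∀ ν : Measure (EuclideanSpace ℝ (Fin n)), IsProbabilityMeasure ν →
      wassersteinDist 1 ν μ ^ 2 ≤ ENNReal.ofReal (4 * C ^ 2) * fisherInfo ν μ)
    {g : EuclideanSpace ℝ (Fin n) → ℝ} (hgd : Differentiable ℝ g) (hg : LipschitzWith 1 g) {M : ℝ}
    (hM : ∀ x, |g x| ≤ M) {t : ℝ} (ht : 0 ≤ t) :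
    ProbabilityTheory.cgf g μ t ≤ t * ∫ x, g x ∂μ + C * t ^ 2 / 2 := by
  have hexp (t : ℝ) : Integrable (fun x => Real.exp (t * g x)) μ :=
    ProbabilityTheory.integrable_exp_mul_of_mem_Icc hg.continuous.aemeasurable
      (.of_forall fun x => abs_le.1 (hM x))
  have hset : ProbabilityTheory.integrableExpSet g μ = Set.univ := Set.eq_univ_of_forall hexp
  have hmem (t : ℝ) : t ∈ interior (ProbabilityTheory.integrableExpSet g μ) := by simp [hset]
  have hbdd (m : Measure (EuclideanSpace ℝ (Fin n))) [IsProbabilityMeasure m] : Integrable g m :=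
    Integrable.of_bound (C := M) hg.continuous.aestronglyMeasurable (.of_forall hM)
  have hd (t : ℝ) : DifferentiableAt ℝ (ProbabilityTheory.cgf g μ) t :=
    (ProbabilityTheory.analyticAt_cgf (hmem t)).differentiableAt
  have hderiv (t : ℝ) (ht : 0 ≤ t) :
      deriv (ProbabilityTheory.cgf g μ) t ≤ ∫ x, g x ∂μ + C * t := by
    have := isProbabilityMeasure_tilted (hexp t)
    rw [← ProbabilityTheory.integral_tilted_mul_self (hmem t)]
    have h1 := (ofReal_integral_sub_le_wassersteinDist hg (hbdd _) (hbdd μ)).trans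
      (wassersteinDist_tilted_le hC hW hgd hg (hexp t))
    rw [abs_of_nonneg ht, ENNReal.ofReal_le_ofReal_iff (by positivity)] at h1
    linarith
  have hF (s : ℝ) : HasDerivAt
      (fun s => ProbabilityTheory.cgf g μ s - (s * ∫ x, g x ∂μ + C * s ^ 2 / 2))
      (deriv (ProbabilityTheory.cgf g μ) s - (∫ x, g x ∂μ + C * s)) s := by
    refine (hd s).hasDerivAt.sub ?_
    have h1 := ((hasDerivAt_id s).mul_const (∫ x, g x ∂μ)).add
      ((((hasDerivAt_id s).pow 2).const_mul C).div_const 2)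
    refine (h1.congr_deriv ?_).congr_of_eventuallyEq (.of_forall fun x => ?_)
    · simp only [id]; norm_num; ring
    · simp
  have hanti : AntitoneOn
      (fun s => ProbabilityTheory.cgf g μ s - (s * ∫ x, g x ∂μ + C * s ^ 2 / 2)) (Set.Ici 0) := by
    refine antitoneOn_of_deriv_nonpos (convex_Ici 0)
      (fun s _ => (hF s).continuousAt.continuousWithinAt)
      (fun s _ => (hF s).differentiableAt.differentiableWithinAt) fun s hs => ?_
    rw [interior_Ici] at hs
    rw [(hF s).deriv]
    linarith [hderiv s hs.le]
  have := hanti (Set.self_mem_Ici) ht ht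
  simp only [ProbabilityTheory.cgf_zero] at this
  linarith

/-- The Gibbs variational inequality. -/
theorem integral_le_integral_llr_add_log {α : Type*} [MeasurableSpace α] {ν μ : Measure α}
    [IsProbabilityMeasure ν] [IsProbabilityMeasure μ] (hac : ν ≪ μ) (hllr : Integrable (llr ν μ) ν)
    {f : α → ℝ} (hf : Integrable f ν) (hexp : Integrable (fun x => Real.exp (f x)) μ) :
    ∫ x, f x ∂ν ≤ ∫ x, llr ν μ x ∂ν + Real.log (∫ x, Real.exp (f x) ∂μ) := by
  have := isProbabilityMeasure_tilted hexp
  have h1 := InformationTheory.integral_llr_add_sub_measure_univ_nonneg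
    (hac.trans (absolutelyContinuous_tilted hexp)) (integrable_llr_tilted_right hac hf hllr hexp)
  rw [integral_llr_tilted_right hac hf hexp hllr] at h1
  simp only [probReal_univ] at h1
  linarith

theorem integral_sub_le_sqrt_of_transport_information (hC : 0 < C)
    (hW : ∀ ν : Measure (EuclideanSpace ℝ (Fin n)), IsProbabilityMeasure ν →
      wassersteinDist 1 ν μ ^ 2 ≤ ENNReal.ofReal (4 * C ^ 2) * fisherInfo ν μ)
    {ν : Measure (EuclideanSpace ℝ (Fin n))} [IsProbabilityMeasure ν] (hac : ν ≪ μ)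
    (hllr : Integrable (llr ν μ) ν) {g : EuclideanSpace ℝ (Fin n) → ℝ} (hg : LipschitzWith 1 g)
    (hM : ∃ M, ∀ x, |g x| ≤ M) :
    ∫ x, g x ∂ν - ∫ x, g x ∂μ ≤ √(2 * C * ∫ x, llr ν μ x ∂ν) := by
  have hbdd {g : EuclideanSpace ℝ (Fin n) → ℝ} (hg : LipschitzWith 1 g) {M : ℝ}
      (hM : ∀ x, |g x| ≤ M) (m : Measure (EuclideanSpace ℝ (Fin n))) [IsProbabilityMeasure m] :
      Integrable g m :=
    Integrable.of_bound (C := M) hg.continuous.aestronglyMeasurable (.of_forall hM)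
  have hsmooth {g : EuclideanSpace ℝ (Fin n) → ℝ} (hgd : Differentiable ℝ g)
      (hg : LipschitzWith 1 g) {M : ℝ} (hM : ∀ x, |g x| ≤ M) :
      ∫ x, g x ∂ν - ∫ x, g x ∂μ ≤ √(2 * C * ∫ x, llr ν μ x ∂ν) := by
    set D := ∫ x, g x ∂ν - ∫ x, g x ∂μ with hD
    rcases le_or_gt D 0 with h0 | h0
    · exact h0.trans (Real.sqrt_nonneg _)
    refine Real.le_sqrt_of_sq_le ?_
    have ht : 0 ≤ D / C := by positivity
    have h1 := cgf_le_of_transport_information hC hW hgd hg hM ht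
    have h2 := integral_le_integral_llr_add_log hac hllr ((hbdd hg hM ν).const_mul (D / C))
      (ProbabilityTheory.integrable_exp_mul_of_mem_Icc hg.continuous.aemeasurable
        (.of_forall fun x => abs_le.1 (hM x)))
    rw [integral_const_mul] at h2
    rw [ProbabilityTheory.cgf, ProbabilityTheory.mgf] at h1
    have h3 : D / C * D ≤ ∫ x, llr ν μ x ∂ν + C * (D / C) ^ 2 / 2 := by
      rw [hD, mul_sub, ← hD]; linarith
    have h4 : D / C * D = D ^ 2 / C := by ring
    have h5 : C * (D / C) ^ 2 / 2 = D ^ 2 / C / 2 := by field_simp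
    rw [h4, h5] at h3
    have h6 : D ^ 2 / C ≤ 2 * ∫ x, llr ν μ x ∂ν := by linarith
    rw [div_le_iff₀ hC] at h6
    linarith
  obtain ⟨M, hM⟩ := hM
  refine le_of_forall_pos_le_add fun ε hε => ?_
  obtain ⟨h, hhd, hh, hclose⟩ := hg.exists_differentiable_dist_le (half_pos hε)
  have hhM (x : EuclideanSpace ℝ (Fin n)) : |h x| ≤ M + ε / 2 := by
    have h1 := abs_le.1 (hclose x)
    have h2 := abs_le.1 (hM x)
    exact abs_le.2 ⟨by linarith, by linarith⟩
  have hdiff (m : Measure (EuclideanSpace ℝ (Fin n))) [IsProbabilityMeasure m] :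
      |∫ x, h x ∂m - ∫ x, g x ∂m| ≤ ε / 2 := by
    rw [← integral_sub (hbdd hh hhM m) (hbdd hg hM m), ← Real.norm_eq_abs]
    simpa using norm_integral_le_of_norm_le_const (μ := m) (f := fun x => h x - g x)
      (.of_forall hclose)
  have h1 := abs_le.1 (hdiff ν)
  have h2 := abs_le.1 (hdiff μ)
  linarith [hsmooth hhd hh hhM]

theorem lintegral_enorm_ne_top_of_transport_information (hC : 0 < C)
    (hW : ∀ ν : Measure (EuclideanSpace ℝ (Fin n)), IsProbabilityMeasure ν →
      wassersteinDist 1 ν μ ^ 2 ≤ ENNReal.ofReal (4 * C ^ 2) * fisherInfo ν μ) :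
    ∫⁻ x, ‖x‖ₑ ∂μ ≠ ⊤ := by
  obtain ⟨g, hgd, hg, hclose⟩ := (lipschitzWith_one_norm
    (E := EuclideanSpace ℝ (Fin n))).exists_differentiable_dist_le one_pos
  have hlow (x : EuclideanSpace ℝ (Fin n)) : ‖x‖ - 1 ≤ g x := by
    linarith [(abs_le.1 (hclose x)).1]
  have hexp : Integrable (fun x => Real.exp (-1 * g x)) μ := by
    refine Integrable.of_bound (C := Real.exp 1) ?_ (.of_forall fun x => ?_)
    · exact (Real.continuous_exp.comp (hg.continuous.const_mul (-1))).aestronglyMeasurable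
    · rw [Real.norm_eq_abs, Real.abs_exp, Real.exp_le_exp]
      linarith [hlow x, norm_nonneg x]
  set ν := μ.tilted fun x => -1 * g x with hν
  have hνfin : ∫⁻ x, ‖x‖ₑ ∂ν ≠ ⊤ := by
    rw [hν, lintegral_tilted]
    have hm : 0 < ∫ x, Real.exp (-1 * g x) ∂μ := integral_exp_pos hexp
    refine ne_top_of_le_ne_top (b := ENNReal.ofReal
      (Real.exp 1 / ∫ x, Real.exp (-1 * g x) ∂μ)) ENNReal.ofReal_ne_top ?_
    refine (lintegral_mono (g := fun _ => ENNReal.ofReal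
      (Real.exp 1 / ∫ x, Real.exp (-1 * g x) ∂μ)) fun x => ?_).trans (by simp)
    rw [← ofReal_norm, ← ENNReal.ofReal_mul (by positivity)]
    refine ENNReal.ofReal_le_ofReal ?_
    rw [div_mul_eq_mul_div]
    gcongr
    calc Real.exp (-1 * g x) * ‖x‖ ≤ Real.exp (-1 * g x) * Real.exp ‖x‖ := by
          gcongr; linarith [Real.add_one_le_exp ‖x‖]
      _ = Real.exp (-1 * g x + ‖x‖) := (Real.exp_add _ _).symm
      _ ≤ Real.exp 1 := by
          rw [Real.exp_le_exp]; linarith [hlow x]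
  have hWfin := (wassersteinDist_tilted_le hC hW hgd hg hexp).trans_lt ENNReal.ofReal_lt_top
  rw [wassersteinDist_one] at hWfin
  simp only [iInf_lt_iff] at hWfin
  obtain ⟨π, ⟨hπ1, hπ2⟩, hπ⟩ := hWfin
  rw [← hν] at hπ1
  rw [← hπ1, lintegral_map measurable_enorm measurable_fst] at hνfin
  conv in μ => rw [← hπ2]
  rw [lintegral_map measurable_enorm measurable_snd]
  refine ne_top_of_le_ne_top (ENNReal.add_ne_top.2 ⟨hπ.ne, hνfin⟩) ?_
  rw [← lintegral_add_left (by fun_prop)]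
  refine lintegral_mono fun q => ?_
  have := edist_triangle q.2 q.1 0
  rwa [edist_comm q.2 q.1, edist_zero_right, edist_zero_right] at this

theorem lintegral_enorm_ne_top_of_integrable_llr (hC : 0 < C)
    (hW : ∀ ν : Measure (EuclideanSpace ℝ (Fin n)), IsProbabilityMeasure ν →
      wassersteinDist 1 ν μ ^ 2 ≤ ENNReal.ofReal (4 * C ^ 2) * fisherInfo ν μ)
    {ν : Measure (EuclideanSpace ℝ (Fin n))} [IsProbabilityMeasure ν] (hac : ν ≪ μ)
    (hllr : Integrable (llr ν μ) ν) : ∫⁻ x, ‖x‖ₑ ∂ν ≠ ⊤ := by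
  have hμ := lintegral_enorm_ne_top_of_transport_information hC hW
  have hμi : Integrable (fun x : EuclideanSpace ℝ (Fin n) => ‖x‖) μ :=
    Integrable.norm ⟨aestronglyMeasurable_id, lt_top_iff_ne_top.2 hμ⟩
  set B := ∫ x, ‖x‖ ∂μ + √(2 * C * ∫ x, llr ν μ x ∂ν) with hB
  have htrunc (k : ℕ) : ∫⁻ x, ENNReal.ofReal (min (k : ℝ) ‖x‖) ∂ν ≤ ENNReal.ofReal B := by
    have hg : LipschitzWith 1 fun x : EuclideanSpace ℝ (Fin n) => min (k : ℝ) ‖x‖ :=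
      lipschitzWith_one_norm.const_min k
    have h0 (x : EuclideanSpace ℝ (Fin n)) : 0 ≤ min (k : ℝ) ‖x‖ := by positivity
    have hM (x : EuclideanSpace ℝ (Fin n)) : |min (k : ℝ) ‖x‖| ≤ k := by
      rw [abs_of_nonneg (h0 x)]; exact min_le_left _ _
    have hbdd (m : Measure (EuclideanSpace ℝ (Fin n))) [IsProbabilityMeasure m] :
        Integrable (fun x => min (k : ℝ) ‖x‖) m :=
      Integrable.of_bound (C := k) hg.continuous.aestronglyMeasurable (.of_forall hM)
    rw [← ofReal_integral_eq_lintegral_ofReal (hbdd ν) (.of_forall h0)]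
    refine ENNReal.ofReal_le_ofReal ?_
    have h1 := integral_sub_le_sqrt_of_transport_information hC hW hac hllr hg ⟨k, hM⟩
    have h2 : ∫ x, min (k : ℝ) ‖x‖ ∂μ ≤ ∫ x, ‖x‖ ∂μ :=
      integral_mono (hbdd μ) hμi fun x => min_le_right _ _
    linarith
  have hsup (x : EuclideanSpace ℝ (Fin n)) :
      ‖x‖ₑ ≤ ⨆ k : ℕ, ENNReal.ofReal (min (k : ℝ) ‖x‖) := by
    obtain ⟨k, hk⟩ := exists_nat_ge ‖x‖
    refine le_iSup_of_le k ?_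
    rw [min_eq_right hk, ofReal_norm]
  refine ne_top_of_le_ne_top (b := ENNReal.ofReal B) ENNReal.ofReal_ne_top ?_
  refine (lintegral_mono hsup).trans ?_
  rw [lintegral_iSup (fun k => by fun_prop) fun k l hkl x => by dsimp only; gcongr]
  exact iSup_le htrunc

end TransportInformation

/-- **W₁I(C) implies W₁H(C)**. -/
theorem W1I_implies_W1H {n : ℕ} (V : EuclideanSpace ℝ (Fin n) → ℝ)
    (hV : ContDiff ℝ 1 V) (Z : ℝ) (hZ : 0 < Z)
    (μ : Measure (EuclideanSpace ℝ (Fin n)))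
    (hμ : μ = volume.withDensity fun x => ENNReal.ofReal (Real.exp (-V x) / Z))
    (hμprob : IsProbabilityMeasure μ)
    (C : ℝ) (hC : 0 < C)
    (hW1I : ∀ ν : Measure (EuclideanSpace ℝ (Fin n)), IsProbabilityMeasure ν →
      wassersteinDist 1 ν μ ^ 2 ≤ ENNReal.ofReal (4 * C ^ 2) * fisherInfo ν μ) :
    ∀ ν : Measure (EuclideanSpace ℝ (Fin n)), IsProbabilityMeasure ν →
      wassersteinDist 1 ν μ ^ 2 ≤ ENNReal.ofReal (2 * C) * relEntropy ν μ := by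
  intro ν hν
  by_cases h : ν ≪ μ ∧ Integrable (llr ν μ) ν
  · obtain ⟨hac, hllr⟩ := h
    rw [relEntropy, if_pos ⟨hac, hllr⟩]
    have hH : 0 ≤ ∫ x, llr ν μ x ∂ν := by
      simpa using InformationTheory.integral_llr_add_sub_measure_univ_nonneg hac hllr
    have h1 := wassersteinDist_one_le_of_forall_lipschitz
      (lintegral_enorm_ne_top_of_integrable_llr hC hW1I hac hllr)
      (lintegral_enorm_ne_top_of_transport_information hC hW1I)
      (Real.sqrt_nonneg (2 * C * ∫ x, llr ν μ x ∂ν)) fun g hg hM =>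
        integral_sub_le_sqrt_of_transport_information hC hW1I hac hllr hg hM
    refine (pow_le_pow_left' h1 2).trans_eq ?_
    rw [← ENNReal.ofReal_pow (Real.sqrt_nonneg _), Real.sq_sqrt (by positivity),
      ENNReal.ofReal_mul (by positivity)]
  · rw [relEntropy, if_neg h, ENNReal.mul_top (by simpa using hC)]
    exact le_top
end

section
/- Suppose μ satisfies the transportation-information inequality W₂I(C), i.e. W₂(ν,μ)² ≤ 4C² I(ν|μ) for all probability measures ν on ℝⁿ. Then μ satisfies the Talagrand inequality W₂H(C), i.e. W₂(ν,μ)² ≤ 2C H(ν|μ) for every probability measure ν on ℝⁿ. -/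
open MeasureTheory ENNReal Classical

section HopfLax

variable {E : Type*} [NormedAddCommGroup E] {f : E → ℝ} {M t : ℝ} {L : NNReal}

/-- The infimal convolution (Hopf–Lax formula) of `f` with `‖·‖² / (2t)`. -/
noncomputable def hopfLax (f : E → ℝ) (t : ℝ) (x : E) : ℝ := ⨅ y, (f y + ‖x - y‖ ^ 2 / (2 * t))

lemma hopfLax_bddBelow (hf : ∀ y, |f y| ≤ M) (ht : 0 < t) (x : E) :
    BddBelow (Set.range fun y => f y + ‖x - y‖ ^ 2 / (2 * t)) := by
  refine ⟨-M, ?_⟩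
  rintro _ ⟨y, rfl⟩
  have h1 := (abs_le.1 (hf y)).1
  have h2 : 0 ≤ ‖x - y‖ ^ 2 / (2 * t) := by positivity
  dsimp only
  linarith

lemma hopfLax_le (hf : ∀ y, |f y| ≤ M) (ht : 0 < t) (x y : E) :
    hopfLax f t x ≤ f y + ‖x - y‖ ^ 2 / (2 * t) :=
  ciInf_le (hopfLax_bddBelow hf ht x) y

lemma abs_hopfLax_le (hf : ∀ y, |f y| ≤ M) (ht : 0 < t) (x : E) : |hopfLax f t x| ≤ M := by
  refine abs_le.2 ⟨le_ciInf fun y => ?_, ?_⟩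
  · have h1 := (abs_le.1 (hf y)).1
    have h2 : 0 ≤ ‖x - y‖ ^ 2 / (2 * t) := by positivity
    linarith
  · have h := hopfLax_le hf ht x x
    have h1 := (abs_le.1 (hf x)).2
    simp only [sub_self, norm_zero] at h
    norm_num at h
    linarith

lemma lipschitzWith_hopfLax (hf : ∀ y, |f y| ≤ M) (hL : LipschitzWith L f) (ht : 0 < t) :
    LipschitzWith L (hopfLax f t) := by
  refine LipschitzWith.of_le_add_mul L fun x x' => ?_
  rw [← sub_le_iff_le_add]
  refine le_ciInf fun y => ?_
  have h := hopfLax_le hf ht x (y + (x - x'))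
  have h1 : x - (y + (x - x')) = x' - y := by abel
  have h2 := hL.le_add_mul (y + (x - x')) y
  have h3 : dist (y + (x - x')) y = dist x x' := by
    rw [dist_eq_norm, dist_eq_norm]; congr 1; abel
  rw [h1] at h
  rw [h3] at h2
  linarith

lemma sq_div_add_le {a b s h : ℝ} (hs : 0 < s) (hh : 0 < h) :
    (a + b) ^ 2 / (2 * (s + h)) ≤ a ^ 2 / (2 * s) + b ^ 2 / (2 * h) := by
  rw [div_add_div _ _ (by positivity) (by positivity), div_le_div_iff₀ (by positivity)
    (by positivity)]
  nlinarith [sq_nonneg (a * h - b * s)]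

lemma hopfLax_add_le (hf : ∀ y, |f y| ≤ M) {s h : ℝ} (hs : 0 < s) (hh : 0 < h) (x y : E) :
    hopfLax f (s + h) x ≤ hopfLax f s y + ‖x - y‖ ^ 2 / (2 * h) := by
  rw [← sub_le_iff_le_add]
  refine le_ciInf fun z => ?_
  have h1 := hopfLax_le hf (add_pos hs hh) x z
  have h2 : ‖x - z‖ ≤ ‖y - z‖ + ‖x - y‖ := by
    rw [add_comm]; exact norm_sub_le_norm_sub_add_norm_sub x y z
  have h3 : ‖x - z‖ ^ 2 / (2 * (s + h)) ≤ (‖y - z‖ + ‖x - y‖) ^ 2 / (2 * (s + h)) := by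
    gcongr
  have h4 := sq_div_add_le (a := ‖y - z‖) (b := ‖x - y‖) hs hh
  linarith

lemma hopfLax_semiconcave [InnerProductSpace ℝ E] (hf : ∀ y, |f y| ≤ M) (ht : 0 < t) {θ : ℝ}
    (h0 : 0 ≤ θ) (h1 : θ ≤ 1) (x v : E) :
    (1 - θ) * hopfLax f t x + θ * hopfLax f t (x + v) ≤
      hopfLax f t (x + θ • v) + θ * (1 - θ) * ‖v‖ ^ 2 / (2 * t) := by
  rw [← sub_le_iff_le_add]
  refine le_ciInf fun y => ?_
  have e1 := mul_le_mul_of_nonneg_left (hopfLax_le hf ht x y) (sub_nonneg.2 h1)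
  have e2 := mul_le_mul_of_nonneg_left (hopfLax_le hf ht (x + v) y) h0
  have e3 : ‖x + v - y‖ ^ 2 = ‖x - y‖ ^ 2 + 2 * inner ℝ (x - y) v + ‖v‖ ^ 2 := by
    rw [← norm_add_sq_real]; congr 2; abel
  have e4 : ‖x + θ • v - y‖ ^ 2 =
      ‖x - y‖ ^ 2 + 2 * (θ * inner ℝ (x - y) v) + θ ^ 2 * ‖v‖ ^ 2 := by
    rw [← sq_abs θ, ← Real.norm_eq_abs, ← mul_pow, ← norm_smul, ← real_inner_smul_right,
      ← norm_add_sq_real]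
    congr 2; abel
  rw [e3] at e2
  rw [e4]
  have key : (1 - θ) * (f y + ‖x - y‖ ^ 2 / (2 * t)) +
      θ * (f y + (‖x - y‖ ^ 2 + 2 * inner ℝ (x - y) v + ‖v‖ ^ 2) / (2 * t)) =
      f y + (‖x - y‖ ^ 2 + 2 * (θ * inner ℝ (x - y) v) + θ ^ 2 * ‖v‖ ^ 2) / (2 * t) +
        θ * (1 - θ) * ‖v‖ ^ 2 / (2 * t) := by
    field_simp
    ring
  linarith

end HopfLax

section Mollify

variable {E : Type*} [NormedAddCommGroup E] [MeasurableSpace E]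

/-- The average of the translates of `u` with respect to `lam`. -/
noncomputable def mollify (lam : Measure E) (u : E → ℝ) (x : E) : ℝ := ∫ z, u (x - z) ∂lam

lemma abs_mollify_le {lam : Measure E} [IsProbabilityMeasure lam] {u : E → ℝ} {M : ℝ}
    (hM : ∀ x, |u x| ≤ M) (x : E) : |mollify lam u x| ≤ M := by
  have h := norm_integral_le_of_norm_le_const (μ := lam) (f := fun z => u (x - z)) (C := M)
    (Filter.Eventually.of_forall fun z => hM (x - z))
  simpa [mollify] using h

lemma integrable_of_continuous_of_abs_le [BorelSpace E] [SecondCountableTopology E]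
    {lam : Measure E} [IsFiniteMeasure lam] {u : E → ℝ} {M : ℝ} (hc : Continuous u)
    (hM : ∀ x, |u x| ≤ M) : Integrable u lam :=
  Integrable.of_bound hc.measurable.aestronglyMeasurable M (Filter.Eventually.of_forall hM)

variable [BorelSpace E] [SecondCountableTopology E] {lam : Measure E} [IsProbabilityMeasure lam]
  {u : E → ℝ} {M : ℝ} {L : NNReal}

lemma integrable_translate (hc : Continuous u) (hM : ∀ x, |u x| ≤ M) (x : E) :
    Integrable (fun z => u (x - z)) lam :=
  integrable_of_continuous_of_abs_le (by fun_prop) fun z => hM (x - z)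

lemma lipschitzWith_mollify (hM : ∀ x, |u x| ≤ M) (hL : LipschitzWith L u) :
    LipschitzWith L (mollify lam u) := by
  refine LipschitzWith.of_le_add_mul L fun x y => ?_
  have h : mollify lam u x ≤ ∫ z, (u (y - z) + L * dist x y) ∂lam := by
    refine integral_mono (integrable_translate hL.continuous hM x)
      ((integrable_translate hL.continuous hM y).add (integrable_const _)) fun z => ?_
    have := hL.le_add_mul (x - z) (y - z)
    rwa [dist_sub_right] at this
  rw [integral_add (integrable_translate hL.continuous hM y) (integrable_const _)] at h
  simpa [mollify] using h

lemma mollify_le_mollify_add {u' : E → ℝ} {M' : ℝ} (hc : Continuous u) (hM : ∀ x, |u x| ≤ M)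
    (hc' : Continuous u') (hM' : ∀ x, |u' x| ≤ M') {x y : E} {b : ℝ}
    (h : ∀ z, u (x - z) ≤ u' (y - z) + b) : mollify lam u x ≤ mollify lam u' y + b := by
  have h : mollify lam u x ≤ ∫ z, (u' (y - z) + b) ∂lam :=
    integral_mono (integrable_translate hc hM x)
      ((integrable_translate hc' hM' y).add (integrable_const _)) h
  rw [integral_add (integrable_translate hc' hM' y) (integrable_const _)] at h
  simpa [mollify] using h

lemma mollify_semiconcave [InnerProductSpace ℝ E] (hc : Continuous u) (hM : ∀ x, |u x| ≤ M)
    {θ b : ℝ} {v : E}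
    (h : ∀ x, (1 - θ) * u x + θ * u (x + v) ≤ u (x + θ • v) + b) (x : E) :
    (1 - θ) * mollify lam u x + θ * mollify lam u (x + v) ≤ mollify lam u (x + θ • v) + b := by
  have i := integrable_translate (lam := lam) hc hM
  have h : ∫ z, ((1 - θ) * u (x - z) + θ * u (x + v - z)) ∂lam ≤
      ∫ z, (u (x + θ • v - z) + b) ∂lam := by
    refine integral_mono (((i x).const_mul _).add ((i (x + v)).const_mul _))
      ((i _).add (integrable_const _)) fun z => ?_
    have := h (x - z)
    rwa [sub_add_eq_add_sub, sub_add_eq_add_sub] at this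
  rw [integral_add ((i x).const_mul _) ((i (x + v)).const_mul _),
    integral_add (i _) (integrable_const _), integral_const_mul, integral_const_mul] at h
  simpa [mollify] using h

lemma abs_mollify_sub_le (hM : ∀ x, |u x| ≤ M) (hL : LipschitzWith L u) {δ : ℝ}
    (hδ : ∀ᵐ z ∂lam, ‖z‖ ≤ δ) (x : E) : |mollify lam u x - u x| ≤ L * δ := by
  have h := norm_integral_le_of_norm_le_const (μ := lam) (f := fun z => u (x - z) - u x)
    (C := L * δ) (by
      filter_upwards [hδ] with z hz
      have := hL.dist_le_mul (x - z) x
      rw [dist_eq_norm, dist_eq_norm] at this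
      refine this.trans ?_
      gcongr
      simpa using hz)
  rw [integral_sub (integrable_translate hL.continuous hM x) (integrable_const _)] at h
  simpa [mollify] using h

end Mollify

lemma exists_smoothing_measure {E : Type*} [NormedAddCommGroup E] [InnerProductSpace ℝ E]
    [FiniteDimensional ℝ E] [MeasurableSpace E] [BorelSpace E] {δ : ℝ} (hδ : 0 < δ) :
    ∃ lam : Measure E, IsProbabilityMeasure lam ∧ (∀ᵐ z ∂lam, ‖z‖ ≤ δ) ∧
      ∀ u : E → ℝ, Continuous u → Differentiable ℝ (mollify lam u) := by
  let φ : ContDiffBump (0 : E) := ⟨δ / 2, δ, by positivity, by linarith⟩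
  have hmeas : Measurable fun z => ENNReal.ofReal (φ.normed volume z) :=
    (φ.continuous_normed.measurable).ennreal_ofReal
  refine ⟨volume.withDensity fun z => ENNReal.ofReal (φ.normed volume z), ⟨?_⟩, ?_, ?_⟩
  · rw [withDensity_apply _ MeasurableSet.univ, setLIntegral_univ,
      ← ofReal_integral_eq_lintegral_ofReal φ.integrable_normed
        (Filter.Eventually.of_forall φ.nonneg_normed), φ.integral_normed, ENNReal.ofReal_one]
  · rw [ae_withDensity_iff hmeas]
    refine Filter.Eventually.of_forall fun z hz => ?_
    have : z ∈ Function.support (φ.normed volume) := fun h => hz (by rw [h, ENNReal.ofReal_zero])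
    rw [φ.support_normed_eq, mem_ball_zero_iff] at this
    exact this.le
  · intro u hu
    have h := (φ.hasCompactSupport_normed (μ := volume)).contDiff_convolution_left
      (ContinuousLinearMap.lsmul ℝ ℝ) (n := 1) (μ := volume)
      φ.contDiff_normed hu.locallyIntegrable
    have heq : mollify (volume.withDensity fun z => ENNReal.ofReal (φ.normed volume z)) u =
        convolution (φ.normed volume) u (ContinuousLinearMap.lsmul ℝ ℝ) volume := by
      ext x
      rw [mollify, integral_withDensity_eq_integral_toReal_smul hmeas
        (Filter.Eventually.of_forall fun _ => ENNReal.ofReal_lt_top)]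
      simp only [ENNReal.toReal_ofReal (φ.nonneg_normed _)]
      rfl
    rw [heq]
    exact h.differentiable (by norm_num)

lemma wassersteinDist_two_sq {n : ℕ} (ν μ : Measure (EuclideanSpace ℝ (Fin n))) :
    wassersteinDist 2 ν μ ^ 2 =
      ⨅ (π : Measure (EuclideanSpace ℝ (Fin n) × EuclideanSpace ℝ (Fin n)))
        (_ : IsCoupling π ν μ), ∫⁻ q, edist q.1 q.2 ^ 2 ∂π := by
  rw [wassersteinDist, ← ENNReal.rpow_two, ← ENNReal.rpow_mul]
  simp

lemma IsCoupling.isProbabilityMeasure {n : ℕ}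
    {π : Measure (EuclideanSpace ℝ (Fin n) × EuclideanSpace ℝ (Fin n))}
    {ν μ : Measure (EuclideanSpace ℝ (Fin n))} [IsProbabilityMeasure ν] (h : IsCoupling π ν μ) :
    IsProbabilityMeasure π := by
  refine ⟨?_⟩
  have h1 : π.map Prod.fst Set.univ = 1 := by rw [h.1]; exact measure_univ
  rwa [Measure.map_apply measurable_fst MeasurableSet.univ] at h1

/-- The easy half of Kantorovich duality. -/
lemma ofReal_integral_sub_le_wassersteinDist_sq {n : ℕ}
    {ν μ : Measure (EuclideanSpace ℝ (Fin n))} [IsProbabilityMeasure ν] [IsProbabilityMeasure μ]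
    {a b : EuclideanSpace ℝ (Fin n) → ℝ} (ha : Integrable a ν) (hb : Integrable b μ)
    (hab : ∀ x y, a x - b y ≤ ‖x - y‖ ^ 2) :
    ENNReal.ofReal (∫ x, a x ∂ν - ∫ y, b y ∂μ) ≤ wassersteinDist 2 ν μ ^ 2 := by
  rw [wassersteinDist_two_sq]
  refine le_iInf₂ fun π hπ => ?_
  obtain ⟨h1, h2⟩ := hπ
  have ha' : Integrable (fun q : _ × _ => a q.1) π := by
    rw [← h1] at ha
    exact ha.comp_measurable measurable_fst
  have hb' : Integrable (fun q : _ × _ => b q.2) π := by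
    rw [← h2] at hb
    exact hb.comp_measurable measurable_snd
  have e : ∫ x, a x ∂ν - ∫ y, b y ∂μ = ∫ q, (a q.1 - b q.2) ∂π := by
    rw [integral_sub ha' hb']
    congr 1
    · rw [← h1, integral_map measurable_fst.aemeasurable (h1 ▸ ha.aestronglyMeasurable)]
    · rw [← h2, integral_map measurable_snd.aemeasurable (h2 ▸ hb.aestronglyMeasurable)]
  rw [e]
  refine (ENNReal.ofReal_le_ofReal (integral_mono (ha'.sub hb') (ha'.sub hb').pos_part
    fun q => le_max_left _ _)).trans ?_
  rw [ofReal_integral_eq_lintegral_ofReal (ha'.sub hb').pos_part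
    (Filter.Eventually.of_forall fun q => le_max_right _ _)]
  refine (lintegral_mono fun q => ?_)
  rw [edist_dist, dist_eq_norm, ← ENNReal.ofReal_pow (norm_nonneg _)]
  exact ENNReal.ofReal_le_ofReal (max_le (hab _ _) (by positivity))

lemma fisherInfo_tilted_le_s3 {n : ℕ} {μ : Measure (EuclideanSpace ℝ (Fin n))}
    [IsProbabilityMeasure μ] {u : EuclideanSpace ℝ (Fin n) → ℝ} (hu : Differentiable ℝ u)
    {M : ℝ} (hM : ∀ x, |u x| ≤ M) {L : NNReal} (hL : LipschitzWith L u) :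
    fisherInfo (μ.tilted u) μ ≤ ENNReal.ofReal (∫ x, ‖gradient u x‖ ^ 2 / 4 ∂(μ.tilted u)) := by
  have hgrad : Measurable fun x => ‖gradient u x‖ := by
    simp only [gradient, LinearIsometryEquiv.norm_map]
    exact (measurable_fderiv ℝ u).norm
  have h_int : Integrable (fun x => Real.exp (u x)) μ :=
    integrable_of_continuous_of_abs_le (M := Real.exp M)
      (Real.continuous_exp.comp hu.continuous) fun x => by
      rw [Real.abs_exp]; exact Real.exp_le_exp.2 (abs_le.1 (hM x)).2
  have : IsProbabilityMeasure (μ.tilted u) := isProbabilityMeasure_tilted h_int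
  have hZ : 0 < ∫ x, Real.exp (u x) ∂μ := integral_exp_pos h_int
  set Z := ∫ x, Real.exp (u x) ∂μ
  have hsqrt : (fun x => Real.sqrt (Real.exp (u x) / Z)) =
      fun x => (√Z)⁻¹ * Real.exp (u x / 2) := by
    ext x
    rw [Real.sqrt_div (Real.exp_pos _).le, Real.exp_half, div_eq_inv_mul]
  refine (iInf₂_le (fun x => Real.exp (u x) / Z) fun x => by positivity).trans ?_
  refine (iInf₂_le (by rfl) (by rw [hsqrt]; fun_prop)).trans ?_
  rw [ofReal_integral_eq_lintegral_ofReal, lintegral_tilted]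
  · refine lintegral_mono fun x => ?_
    have hd : fderiv ℝ (fun y => (√Z)⁻¹ * Real.exp (u y / 2)) x =
        ((√Z)⁻¹ * (Real.exp (u x / 2) / 2)) • fderiv ℝ u x := by
      have h1 := (((hu x).hasFDerivAt.mul_const (2⁻¹ : ℝ)).exp.const_mul (√Z)⁻¹).fderiv
      simp only [← div_eq_mul_inv] at h1
      rw [h1, smul_smul, smul_smul]
      congr 1
      ring
    rw [hsqrt, ← enorm_eq_nnnorm, ← ofReal_norm, ← ENNReal.ofReal_pow (norm_nonneg _),
      ← ENNReal.ofReal_mul (by positivity)]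
    refine ENNReal.ofReal_le_ofReal (le_of_eq ?_)
    simp only [gradient, LinearIsometryEquiv.norm_map]
    rw [hd, norm_smul, mul_pow, Real.norm_eq_abs, sq_abs, mul_pow, inv_pow, Real.sq_sqrt hZ.le,
      div_pow, ← Real.exp_nat_mul]
    push_cast
    rw [mul_div_cancel₀ _ two_ne_zero]
    ring
  · refine Integrable.of_bound ((hgrad.pow_const 2).div_const 4).aestronglyMeasurable ((L : ℝ) ^ 2 / 4)
      (Filter.Eventually.of_forall fun x => ?_)
    rw [Real.norm_of_nonneg (by positivity)]
    gcongr
    simp only [gradient, LinearIsometryEquiv.norm_map]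
    exact norm_fderiv_le_of_lipschitz ℝ hL
  · exact Filter.Eventually.of_forall fun x => by positivity

/-- The properties of a (mollified) Hopf–Lax evolution started from `F` that are used to
differentiate its exponential moments. -/
structure IsHopfLaxFamily {E : Type*} [NormedAddCommGroup E] [InnerProductSpace ℝ E]
    (F : E → ℝ) (g : ℝ → E → ℝ) (M : ℝ) (L : NNReal) : Prop where
  le_initial : ∀ {t : ℝ}, 0 < t → ∀ x y, g t x ≤ F y + ‖x - y‖ ^ 2 / (2 * t)
  le_semigroup : ∀ {s h : ℝ}, 0 < s → 0 < h → ∀ x y,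
    g (s + h) x ≤ g s y + ‖x - y‖ ^ 2 / (2 * h)
  differentiable : ∀ {t : ℝ}, 0 < t → Differentiable ℝ (g t)
  lipschitz : ∀ {t : ℝ}, 0 < t → LipschitzWith L (g t)
  abs_apply_le : ∀ {t : ℝ}, 0 < t → ∀ x, |g t x| ≤ M
  semiconcave : ∀ {t θ : ℝ}, 0 < t → 0 ≤ θ → θ ≤ 1 → ∀ x v,
    (1 - θ) * g t x + θ * g t (x + v) ≤ g t (x + θ • v) + θ * (1 - θ) * ‖v‖ ^ 2 / (2 * t)

lemma isHopfLaxFamily_mollify {E : Type*} [NormedAddCommGroup E] [InnerProductSpace ℝ E]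
    [MeasurableSpace E] [BorelSpace E] [SecondCountableTopology E] {lam : Measure E}
    [IsProbabilityMeasure lam]
    (hlam : ∀ u : E → ℝ, Continuous u → Differentiable ℝ (mollify lam u))
    {f : E → ℝ} {M : ℝ} {L : NNReal} (hM : ∀ x, |f x| ≤ M) (hL : LipschitzWith L f) :
    IsHopfLaxFamily (mollify lam f) (fun t => mollify lam (hopfLax f t)) M L where
  le_initial {t} ht x y := by
    refine mollify_le_mollify_add (lipschitzWith_hopfLax hM hL ht).continuous
      (abs_hopfLax_le hM ht) hL.continuous hM fun z => ?_
    simpa using hopfLax_le hM ht (x - z) (y - z)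
  le_semigroup {s h} hs hh x y := by
    refine mollify_le_mollify_add (lipschitzWith_hopfLax hM hL (add_pos hs hh)).continuous
      (abs_hopfLax_le hM (add_pos hs hh)) (lipschitzWith_hopfLax hM hL hs).continuous
      (abs_hopfLax_le hM hs) fun z => ?_
    simpa using hopfLax_add_le hM hs hh (x - z) (y - z)
  differentiable ht := hlam _ (lipschitzWith_hopfLax hM hL ht).continuous
  lipschitz ht := lipschitzWith_mollify (abs_hopfLax_le hM ht) (lipschitzWith_hopfLax hM hL ht)
  abs_apply_le ht := abs_mollify_le (abs_hopfLax_le hM ht)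
  semiconcave ht h0 h1 x v := mollify_semiconcave (lipschitzWith_hopfLax hM hL ht).continuous
    (abs_hopfLax_le hM ht) (fun x => hopfLax_semiconcave hM ht h0 h1 x v) x

section Family

variable {E : Type*} [NormedAddCommGroup E] [InnerProductSpace ℝ E] {F : E → ℝ} {g : ℝ → E → ℝ}
  {M : ℝ} {L : NNReal}

lemma IsHopfLaxFamily.apply_add_le (hg : IsHopfLaxFamily F g M L) {t : ℝ} (ht : 0 < t) (x v : E) :
    g t (x + v) ≤ g t x + fderiv ℝ (g t) x v + ‖v‖ ^ 2 / (2 * t) := by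
  have hd : HasDerivAt (fun θ : ℝ => g t (x + θ • v)) (fderiv ℝ (g t) x v) 0 := by
    have := (hg.differentiable ht x).hasFDerivAt.hasLineDerivAt v
    exact this
  have hlim := hd.tendsto_slope_zero_right
  have hge : g t (x + v) - g t x - ‖v‖ ^ 2 / (2 * t) ≤ fderiv ℝ (g t) x v := by
    refine ge_of_tendsto hlim ?_
    filter_upwards [Ioo_mem_nhdsGT (zero_lt_one (α := ℝ))] with θ hθ
    have h := hg.semiconcave ht hθ.1.le hθ.2.le x v
    simp only [zero_add, zero_smul, add_zero, smul_eq_mul]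
    rw [← div_eq_inv_mul, le_div_iff₀ hθ.1]
    have h2 : θ * (1 - θ) * ‖v‖ ^ 2 / (2 * t) ≤ θ * (‖v‖ ^ 2 / (2 * t)) := by
      rw [mul_assoc, mul_div_assoc]
      refine mul_le_mul_of_nonneg_left ?_ hθ.1.le
      gcongr
      nlinarith [sq_nonneg ‖v‖, hθ.1]
    linarith
  linarith

lemma IsHopfLaxFamily.decrease [CompleteSpace E] (hg : IsHopfLaxFamily F g M L) {t h : ℝ}
    (ht : 0 < t) (hh : 0 < h) (x : E) :
    g (t + h) x ≤ g t x - h / 2 * ‖gradient (g t) x‖ ^ 2 +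
      h ^ 2 * ‖gradient (g t) x‖ ^ 2 / (2 * t) := by
  set p := gradient (g t) x with hp
  have h1 := hg.le_semigroup ht hh x (x + (-h) • p)
  have h2 := hg.apply_add_le ht x ((-h) • p)
  have h3 : fderiv ℝ (g t) x ((-h) • p) = -h * ‖p‖ ^ 2 := by
    rw [map_smul, ← inner_gradient_left, ← hp, real_inner_self_eq_norm_sq, smul_eq_mul]
  have h4 : ‖x - (x + (-h) • p)‖ ^ 2 / (2 * h) = h / 2 * ‖p‖ ^ 2 := by
    rw [sub_add_cancel_left, norm_neg, norm_smul, mul_pow, Real.norm_eq_abs, sq_abs]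
    field_simp
  have h5 : ‖(-h) • p‖ ^ 2 = h ^ 2 * ‖p‖ ^ 2 := by
    rw [norm_smul, mul_pow, Real.norm_eq_abs, sq_abs, neg_sq]
  rw [h3, h5] at h2
  rw [h4] at h1
  linarith

lemma IsHopfLaxFamily.norm_gradient_le [CompleteSpace E] (hg : IsHopfLaxFamily F g M L) {t : ℝ}
    (ht : 0 < t) (x : E) : ‖gradient (g t) x‖ ≤ L := by
  simp only [gradient, LinearIsometryEquiv.norm_map]
  exact norm_fderiv_le_of_lipschitz ℝ (hg.lipschitz ht)

end Family

section Moments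

variable {n : ℕ} {μ : Measure (EuclideanSpace ℝ (Fin n))} [IsProbabilityMeasure μ]
  {C : ℝ} {F : EuclideanSpace ℝ (Fin n) → ℝ} {g : ℝ → EuclideanSpace ℝ (Fin n) → ℝ} {M : ℝ}
  {L : NNReal}

lemma IsHopfLaxFamily.integrable_gradient (hg : IsHopfLaxFamily F g M L) {t : ℝ} (ht : 0 < t)
    (ν : Measure (EuclideanSpace ℝ (Fin n))) [IsFiniteMeasure ν] :
    Integrable (fun x => ‖gradient (g t) x‖ ^ 2) ν := by
  have hgrad : Measurable fun x => ‖gradient (g t) x‖ := by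
    simp only [gradient, LinearIsometryEquiv.norm_map]
    exact (measurable_fderiv ℝ (g t)).norm
  refine Integrable.of_bound (hgrad.pow_const 2).aestronglyMeasurable ((L : ℝ) ^ 2)
    (Filter.Eventually.of_forall fun x => ?_)
  rw [Real.norm_of_nonneg (by positivity)]
  gcongr
  exact hg.norm_gradient_le ht x

lemma IsHopfLaxFamily.integrable_exp (hg : IsHopfLaxFamily F g M L) {t : ℝ} (ht : 0 < t)
    {c : ℝ} (hc : 0 ≤ c) : Integrable (fun x => Real.exp (c * g t x)) μ :=
  integrable_of_continuous_of_abs_le (M := Real.exp (c * M))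
    (Real.continuous_exp.comp (continuous_const.mul (hg.differentiable ht).continuous)) fun x => by
      rw [Real.abs_exp]
      exact Real.exp_le_exp.2 (mul_le_mul_of_nonneg_left (abs_le.1 (hg.abs_apply_le ht x)).2 hc)

lemma IsHopfLaxFamily.integral_tilted_le (hg : IsHopfLaxFamily F g M L) (hC : 0 < C)
    (hW2I : ∀ ν : Measure (EuclideanSpace ℝ (Fin n)), IsProbabilityMeasure ν →
      wassersteinDist 2 ν μ ^ 2 ≤ ENNReal.ofReal (4 * C ^ 2) * fisherInfo ν μ)
    (hF : Integrable F μ) {t : ℝ} (ht : 0 < t) :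
    ∫ x, (g t x - t / 2 * ‖gradient (g t) x‖ ^ 2) ∂(μ.tilted fun x => t / C * g t x) ≤
      ∫ x, F x ∂μ := by
  have : IsProbabilityMeasure (μ.tilted fun x => t / C * g t x) :=
    isProbabilityMeasure_tilted (hg.integrable_exp ht (by positivity))
  set ν := μ.tilted fun x => t / C * g t x with hν
  have hgi : Integrable (g t) ν :=
    integrable_of_continuous_of_abs_le (hg.differentiable ht).continuous (hg.abs_apply_le ht)
  have h1 := ofReal_integral_sub_le_wassersteinDist_sq (hgi.const_mul (2 * t))
    (hF.const_mul (2 * t)) fun x y => by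
      have := mul_le_mul_of_nonneg_left (hg.le_initial ht x y) (by positivity : 0 ≤ 2 * t)
      rw [mul_add, mul_div_cancel₀ _ (by positivity)] at this
      linarith
  have hgrad : ∀ x, ‖gradient (fun x => t / C * g t x) x‖ = t / C * ‖gradient (g t) x‖ := by
    intro x
    simp only [gradient, LinearIsometryEquiv.norm_map]
    rw [fderiv_const_mul (hg.differentiable ht x), norm_smul, Real.norm_of_nonneg (by positivity)]
  have h2 := fisherInfo_tilted_le_s3 (μ := μ) ((hg.differentiable ht).const_mul (t / C))
    (M := t / C * M) (fun x => by
      rw [abs_mul, abs_of_nonneg (by positivity)]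
      exact mul_le_mul_of_nonneg_left (hg.abs_apply_le ht x) (by positivity))
    (L := ‖t / C‖₊ * L) ((lipschitzWith_smul (t / C)).comp (hg.lipschitz ht))
  have h3 := h1.trans ((hW2I ν inferInstance).trans (mul_le_mul_right h2 _))
  rw [← ENNReal.ofReal_mul (by positivity),
    ENNReal.ofReal_le_ofReal_iff (mul_nonneg (by positivity)
      (integral_nonneg fun x => by positivity)), ← integral_const_mul] at h3
  simp only [hgrad] at h3
  have e : ∀ x, 4 * C ^ 2 * ((t / C * ‖gradient (g t) x‖) ^ 2 / 4) =
      t ^ 2 * ‖gradient (g t) x‖ ^ 2 := fun x => by field_simp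
  simp only [e] at h3
  rw [integral_const_mul, integral_const_mul, integral_const_mul] at h3
  rw [integral_sub hgi ((hg.integrable_gradient ht ν).const_mul _), integral_const_mul]
  have h4 : 2 * t * (∫ x, g t x ∂ν - t / 2 * ∫ x, ‖gradient (g t) x‖ ^ 2 ∂ν) ≤
      2 * t * ∫ x, F x ∂μ := by linarith
  exact le_of_mul_le_mul_left h4 (by positivity)

lemma IsHopfLaxFamily.integral_exp_step (hg : IsHopfLaxFamily F g M L) (hC : 0 < C)
    (hW2I : ∀ ν : Measure (EuclideanSpace ℝ (Fin n)), IsProbabilityMeasure ν →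
      wassersteinDist 2 ν μ ^ 2 ≤ ENNReal.ofReal (4 * C ^ 2) * fisherInfo ν μ)
    (hF : Integrable F μ) {t h : ℝ} (hh : 0 < h) (hht : h ≤ t) (ht1 : t + h ≤ 1)
    (hsmall : h / C * (M + L ^ 2) ≤ 1) :
    ∫ x, Real.exp ((t + h) / C * g (t + h) x) ∂μ ≤
      (∫ x, Real.exp (t / C * g t x) ∂μ) * Real.exp (h / C * ∫ x, F x ∂μ +
        (L ^ 2 / (2 * C) + ((M + L ^ 2) / C) ^ 2) * h ^ 2) := by
  have ht : 0 < t := hh.trans_le hht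
  have hM : 0 ≤ M := (abs_nonneg _).trans (hg.abs_apply_le ht 0)
  have h_int : Integrable (fun x => Real.exp (t / C * g t x)) μ :=
    hg.integrable_exp ht (by positivity)
  have : IsProbabilityMeasure (μ.tilted fun x => t / C * g t x) :=
    isProbabilityMeasure_tilted h_int
  have hcore := hg.integral_tilted_le hC hW2I hF ht
  set ν := μ.tilted fun x => t / C * g t x with hν
  set A : ℝ := M + L ^ 2 with hA
  set q : EuclideanSpace ℝ (Fin n) → ℝ := fun x => g t x - t / 2 * ‖gradient (g t) x‖ ^ 2 with hq
  set y : EuclideanSpace ℝ (Fin n) → ℝ := fun x => h / C * (q x + h * L ^ 2 / 2) with hy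
  have hqi : Integrable q ν :=
    (integrable_of_continuous_of_abs_le (hg.differentiable ht).continuous
      (hg.abs_apply_le ht)).sub ((hg.integrable_gradient ht ν).const_mul _)
  have hyi : Integrable y ν := (hqi.add (integrable_const _)).const_mul _
  have hp2 : ∀ x, ‖gradient (g t) x‖ ^ 2 ≤ (L : ℝ) ^ 2 := fun x => by
    gcongr
    exact hg.norm_gradient_le ht x
  have hyabs : ∀ x, |y x| ≤ h / C * A := by
    intro x
    rw [hy, abs_mul, abs_of_nonneg (by positivity : 0 ≤ h / C)]
    refine mul_le_mul_of_nonneg_left (abs_le.2 ?_) (by positivity)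
    have h1 := abs_le.1 (hg.abs_apply_le ht x)
    have h2 : t / 2 * ‖gradient (g t) x‖ ^ 2 ≤ 1 / 2 * (L : ℝ) ^ 2 :=
      mul_le_mul (by linarith) (hp2 x) (by positivity) (by positivity)
    have h3 : 0 ≤ t / 2 * ‖gradient (g t) x‖ ^ 2 := by positivity
    have h4 : h * (L : ℝ) ^ 2 / 2 ≤ 1 / 2 * (L : ℝ) ^ 2 := by
      rw [mul_div_right_comm]
      gcongr
      linarith
    have h5 : 0 ≤ h * (L : ℝ) ^ 2 / 2 := by positivity
    have h6 : 0 ≤ (L : ℝ) ^ 2 := by positivity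
    simp only [hq]
    constructor <;> linarith
  have hpt : ∀ x, (t + h) / C * g (t + h) x ≤ t / C * g t x + y x := by
    intro x
    have h1 := hg.decrease ht hh x
    set P := ‖gradient (g t) x‖ ^ 2 with hP
    have hP0 : 0 ≤ P := by positivity
    have h2 : (t + h) * g (t + h) x ≤ t * g t x + h * (q x + h * L ^ 2 / 2) := by
      have h3 := mul_le_mul_of_nonneg_left h1 (by linarith : 0 ≤ t + h)
      have h4 : (t + h) * (g t x - h / 2 * P + h ^ 2 * P / (2 * t)) =
          t * g t x + h * (g t x - t / 2 * P) + h / t * (h ^ 2 * P / 2) := by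
        field_simp
        ring
      have h5 : h / t * (h ^ 2 * P / 2) ≤ 1 * (h ^ 2 * L ^ 2 / 2) := by
        gcongr
        · exact (div_le_one ht).2 hht
        · exact hp2 x
      simp only [hq]
      rw [h4] at h3
      linarith
    have h3 := div_le_div_of_nonneg_right h2 hC.le
    calc (t + h) / C * g (t + h) x = (t + h) * g (t + h) x / C := by ring
      _ ≤ _ := h3
      _ = t / C * g t x + y x := by simp only [hy]; ring
  have hexpy : ∀ x, Real.exp (y x) ≤ y x + (1 + (h / C * A) ^ 2) := by
    intro x
    have h1 := (abs_le.1 (Real.abs_exp_sub_one_sub_id_le ((hyabs x).trans hsmall))).2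
    have h2 : y x ^ 2 ≤ (h / C * A) ^ 2 := sq_le_sq' (abs_le.1 (hyabs x)).1 (abs_le.1 (hyabs x)).2
    linarith
  have hyint : ∫ x, y x ∂ν ≤ h / C * (∫ x, F x ∂μ + h * L ^ 2 / 2) := by
    rw [hy, integral_const_mul, integral_add hqi (integrable_const _)]
    simp only [integral_const, probReal_univ, one_smul]
    gcongr
  have hexpyi : Integrable (fun x => Real.exp (y x)) ν := by
    refine Integrable.of_bound (C := Real.exp 1)
      (Real.continuous_exp.comp_aestronglyMeasurable hyi.aestronglyMeasurable)
      (Filter.Eventually.of_forall fun x => ?_)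
    rw [Real.norm_eq_abs, Real.abs_exp]
    exact Real.exp_le_exp.2 ((le_abs_self _).trans ((hyabs x).trans hsmall))
  have hprod : ∫ x, Real.exp (t / C * g t x + y x) ∂μ =
      (∫ x, Real.exp (t / C * g t x) ∂μ) * ∫ x, Real.exp (y x) ∂ν := by
    rw [hν, integral_exp_tilted, mul_div_cancel₀ _ (integral_exp_pos h_int).ne']
    rfl
  have hprodi : Integrable (fun x => Real.exp (t / C * g t x + y x)) μ := by
    rw [hν, integrable_tilted_iff h_int] at hexpyi
    simpa [Real.exp_add] using hexpyi
  calc ∫ x, Real.exp ((t + h) / C * g (t + h) x) ∂μ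
      ≤ ∫ x, Real.exp (t / C * g t x + y x) ∂μ :=
        integral_mono (hg.integrable_exp (by linarith) (div_nonneg (by linarith) hC.le)) hprodi
          fun x => Real.exp_le_exp.2 (hpt x)
    _ = (∫ x, Real.exp (t / C * g t x) ∂μ) * ∫ x, Real.exp (y x) ∂ν := hprod
    _ ≤ _ := by
      refine mul_le_mul_of_nonneg_left ?_ (integral_exp_pos h_int).le
      have h1 : ∫ x, Real.exp (y x) ∂ν ≤ ∫ x, (y x + (1 + (h / C * A) ^ 2)) ∂ν :=
        integral_mono hexpyi (hyi.add (integrable_const _)) hexpy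
      rw [integral_add hyi (integrable_const _)] at h1
      simp only [integral_const, probReal_univ, one_smul] at h1
      refine h1.trans (le_trans ?_ (Real.add_one_le_exp _))
      have e : h / C * (∫ x, F x ∂μ + h * L ^ 2 / 2) + (h / C * A) ^ 2 =
          h / C * ∫ x, F x ∂μ + (L ^ 2 / (2 * C) + (A / C) ^ 2) * h ^ 2 := by
        field_simp
        ring
      linarith

lemma IsHopfLaxFamily.integral_exp_le (hg : IsHopfLaxFamily F g M L) (hC : 0 < C)
    (hW2I : ∀ ν : Measure (EuclideanSpace ℝ (Fin n)), IsProbabilityMeasure ν →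
      wassersteinDist 2 ν μ ^ 2 ≤ ENNReal.ofReal (4 * C ^ 2) * fisherInfo ν μ)
    (hF : Integrable F μ) :
    ∫ x, Real.exp (1 / C * g 1 x) ∂μ ≤ Real.exp (1 / C * ∫ x, F x ∂μ) := by
  set m := ∫ x, F x ∂μ with hm
  set K : ℝ := L ^ 2 / (2 * C) + ((M + L ^ 2) / C) ^ 2 with hK
  have hK0 : 0 ≤ K := by positivity
  have hM : 0 ≤ M := (abs_nonneg _).trans (hg.abs_apply_le one_pos 0)
  have hbound : ∀ N : ℕ, 0 < N → (M + L ^ 2) / C ≤ N →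
      ∫ x, Real.exp (1 / C * g 1 x) ∂μ ≤
        Real.exp (1 / C * m + ((M + |m|) / C + K) * (N : ℝ)⁻¹) := by
    intro N hN hNA
    have hN' : (0 : ℝ) < N := by exact_mod_cast hN
    set h : ℝ := (N : ℝ)⁻¹ with hh
    have hh0 : 0 < h := by positivity
    have hNh : (N : ℝ) * h = 1 := mul_inv_cancel₀ hN'.ne'
    have hind : ∀ k : ℕ, k + 1 ≤ N →
        ∫ x, Real.exp ((k + 1) * h / C * g ((k + 1) * h) x) ∂μ ≤
          Real.exp (h * M / C + k * (h / C * m + K * h ^ 2)) := by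
      intro k
      induction k with
      | zero =>
        intro _
        have hi := hg.integrable_exp (μ := μ) hh0 (c := h / C) (by positivity)
        have h1 : ∫ x, Real.exp (h / C * g h x) ∂μ ≤ ∫ _, Real.exp (h * M / C) ∂μ := by
          refine integral_mono hi (integrable_const _) fun x => Real.exp_le_exp.2 ?_
          rw [mul_div_right_comm]
          exact mul_le_mul_of_nonneg_left (abs_le.1 (hg.abs_apply_le hh0 x)).2 (by positivity)
        simpa using h1
      | succ k ih =>
        intro hk
        have hk1 : ((k : ℝ) + 1 + 1) * h ≤ 1 := by
          refine (mul_le_mul_of_nonneg_right ?_ hh0.le).trans_eq hNh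
          exact_mod_cast hk
        have hstep := hg.integral_exp_step hC hW2I hF (t := (k + 1) * h) hh0
          (by nlinarith [mul_nonneg k.cast_nonneg hh0.le]) (by linarith) (by
            rw [div_mul_eq_mul_div, mul_div_assoc, ← hNh, mul_comm (N : ℝ)]
            gcongr)
        rw [← hm, ← hK] at hstep
        have e : ((k : ℝ) + 1) * h + h = (((k + 1 : ℕ) : ℝ) + 1) * h := by push_cast; ring
        rw [e] at hstep
        refine hstep.trans ((mul_le_mul_of_nonneg_right (ih (by omega))
          (Real.exp_pos _).le).trans_eq ?_)
        rw [← Real.exp_add]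
        congr 1
        push_cast
        ring
    have h1 := hind (N - 1) (by omega)
    have e : ((N - 1 : ℕ) : ℝ) + 1 = N := by
      rw [← Nat.cast_add_one, Nat.sub_add_cancel hN]
    have e' : ((N - 1 : ℕ) : ℝ) = N - 1 := by linarith
    rw [e, hNh, e'] at h1
    refine h1.trans (Real.exp_le_exp.2 ?_)
    have e2 : h * M / C + (N - 1) * (h / C * m + K * h ^ 2) =
        h * M / C + (N * h) * (m / C) + (N * h) * (K * h) - h * m / C - K * h ^ 2 := by ring
    rw [e2, hNh]
    have h2 : -(h * m / C) ≤ h * |m| / C := by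
      rw [← neg_div, ← mul_neg]
      gcongr
      exact neg_le_abs m
    have h3 : 0 ≤ K * h ^ 2 := by positivity
    have e3 : 1 / C * m + ((M + |m|) / C + K) * h =
        h * M / C + m / C + K * h + h * |m| / C := by ring
    rw [e3]
    linarith
  have hlim : Filter.Tendsto
      (fun N : ℕ => Real.exp (1 / C * m + ((M + |m|) / C + K) * (N : ℝ)⁻¹)) Filter.atTop
      (nhds (Real.exp (1 / C * m + ((M + |m|) / C + K) * 0))) :=
    (Real.continuous_exp.tendsto _).comp
      ((tendsto_inv_atTop_nhds_zero_nat.const_mul _).const_add _)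
  rw [mul_zero, add_zero] at hlim
  refine ge_of_tendsto hlim ?_
  filter_upwards [Filter.eventually_gt_atTop 0,
    Filter.eventually_ge_atTop ⌈(M + L ^ 2) / C⌉₊] with N h1 h2
  exact hbound N h1 ((Nat.le_ceil _).trans (by exact_mod_cast h2))

/-- The infimum-convolution (dual) form of Talagrand's inequality. -/
theorem integral_exp_hopfLax_le (hC : 0 < C)
    (hW2I : ∀ ν : Measure (EuclideanSpace ℝ (Fin n)), IsProbabilityMeasure ν →
      wassersteinDist 2 ν μ ^ 2 ≤ ENNReal.ofReal (4 * C ^ 2) * fisherInfo ν μ)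
    {f : EuclideanSpace ℝ (Fin n) → ℝ} (hM : ∀ x, |f x| ≤ M) (hL : LipschitzWith L f) :
    ∫ x, Real.exp (1 / C * hopfLax f 1 x) ∂μ ≤ Real.exp (1 / C * ∫ x, f x ∂μ) := by
  have hQ := lipschitzWith_hopfLax hM hL one_pos
  have hfi : Integrable f μ := integrable_of_continuous_of_abs_le hL.continuous hM
  have hbound : ∀ δ : ℝ, 0 < δ → ∫ x, Real.exp (1 / C * hopfLax f 1 x) ∂μ ≤
      Real.exp (1 / C * (∫ x, f x ∂μ + 2 * L * δ)) := by
    intro δ hδ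
    obtain ⟨lam, hlam, hsupp, hdiff⟩ :=
      exists_smoothing_measure (E := EuclideanSpace ℝ (Fin n)) hδ
    have hg := isHopfLaxFamily_mollify hdiff hM hL
    have hFi : Integrable (mollify lam f) μ := integrable_of_continuous_of_abs_le
      (lipschitzWith_mollify hM hL).continuous (abs_mollify_le hM)
    have h1 := hg.integral_exp_le hC hW2I hFi
    have h2 : ∫ x, mollify lam f x ∂μ ≤ ∫ x, (f x + L * δ) ∂μ :=
      integral_mono hFi (hfi.add (integrable_const _)) fun x => by
        linarith [(abs_le.1 (abs_mollify_sub_le hM hL hsupp x)).2]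
    rw [integral_add hfi (integrable_const _)] at h2
    simp only [integral_const, probReal_univ, one_smul] at h2
    have h3 : ∫ x, Real.exp (1 / C * hopfLax f 1 x) ∂μ ≤
        ∫ x, Real.exp (1 / C * mollify lam (hopfLax f 1) x) * Real.exp (1 / C * (L * δ)) ∂μ := by
      refine integral_mono (integrable_of_continuous_of_abs_le (M := Real.exp (1 / C * M))
        (Real.continuous_exp.comp (continuous_const.mul hQ.continuous)) fun x => ?_)
        ((hg.integrable_exp one_pos (by positivity)).mul_const _) fun x => ?_
      · rw [Real.abs_exp]
        exact Real.exp_le_exp.2 (mul_le_mul_of_nonneg_left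
          (abs_le.1 (abs_hopfLax_le hM one_pos x)).2 (by positivity))
      · dsimp only
        rw [← Real.exp_add, ← mul_add]
        refine Real.exp_le_exp.2 (mul_le_mul_of_nonneg_left ?_ (by positivity))
        linarith [(abs_le.1 (abs_mollify_sub_le (abs_hopfLax_le hM one_pos) hQ hsupp x)).1]
    rw [integral_mul_const] at h3
    refine h3.trans ((mul_le_mul_of_nonneg_right h1 (Real.exp_pos _).le).trans ?_)
    rw [← Real.exp_add, ← mul_add]
    refine Real.exp_le_exp.2 (mul_le_mul_of_nonneg_left ?_ (by positivity))
    linarith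
  have hlim : Filter.Tendsto (fun δ : ℝ => Real.exp (1 / C * (∫ x, f x ∂μ + 2 * L * δ)))
      (nhdsWithin 0 (Set.Ioi 0)) (nhds (Real.exp (1 / C * (∫ x, f x ∂μ + 2 * L * 0)))) :=
    (Continuous.tendsto (by fun_prop) 0).mono_left nhdsWithin_le_nhds
  rw [mul_zero, add_zero] at hlim
  refine ge_of_tendsto hlim ?_
  filter_upwards [self_mem_nhdsWithin] with δ hδ using hbound δ hδ

/-- Talagrand's inequality tested against a Lipschitz potential. -/
theorem integral_hopfLax_le_add_entropy (hC : 0 < C)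
    (hW2I : ∀ ν : Measure (EuclideanSpace ℝ (Fin n)), IsProbabilityMeasure ν →
      wassersteinDist 2 ν μ ^ 2 ≤ ENNReal.ofReal (4 * C ^ 2) * fisherInfo ν μ)
    {ν : Measure (EuclideanSpace ℝ (Fin n))} [IsProbabilityMeasure ν] (hνμ : ν ≪ μ)
    (hllr : Integrable (llr ν μ) ν)
    {f : EuclideanSpace ℝ (Fin n) → ℝ} (hM : ∀ x, |f x| ≤ M) (hL : LipschitzWith L f) :
    ∫ x, hopfLax f 1 x ∂ν ≤ ∫ x, f x ∂μ + C * ∫ x, llr ν μ x ∂ν := by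
  have hQ := (lipschitzWith_hopfLax hM hL one_pos).continuous
  have hQM := abs_hopfLax_le hM (one_pos : (0 : ℝ) < 1)
  have hi : Integrable (fun x => 1 / C * hopfLax f 1 x) ν :=
    (integrable_of_continuous_of_abs_le hQ hQM).const_mul _
  have hexp : Integrable (fun x => Real.exp (1 / C * hopfLax f 1 x)) μ :=
    integrable_of_continuous_of_abs_le (M := Real.exp (1 / C * M))
      (Real.continuous_exp.comp (continuous_const.mul hQ)) fun x => by
        rw [Real.abs_exp]
        exact Real.exp_le_exp.2 (mul_le_mul_of_nonneg_left (abs_le.1 (hQM x)).2 (by positivity))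
  have : IsProbabilityMeasure (μ.tilted fun x => 1 / C * hopfLax f 1 x) :=
    isProbabilityMeasure_tilted hexp
  have h1 := InformationTheory.integral_llr_add_sub_measure_univ_nonneg
    (hνμ.trans (absolutelyContinuous_tilted hexp)) (integrable_llr_tilted_right hνμ hi hllr hexp)
  rw [integral_llr_tilted_right hνμ hi hexp hllr, integral_const_mul] at h1
  simp only [probReal_univ] at h1
  have h2 := (Real.log_le_log (integral_exp_pos hexp)
    (integral_exp_hopfLax_le hC hW2I hM hL)).trans_eq (Real.log_exp _)
  have h3 : 1 / C * ∫ x, hopfLax f 1 x ∂ν ≤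
      1 / C * (∫ x, f x ∂μ + C * ∫ x, llr ν μ x ∂ν) := by
    rw [mul_add, ← mul_assoc (1 / C) C, one_div_mul_cancel hC.ne', one_mul]
    linarith
  exact le_of_mul_le_mul_left h3 (by positivity)

end Moments

section FiniteTransport

variable {ι : Type*} [Fintype ι]

/-- Finite-dimensional Kantorovich duality. -/
lemma exists_transport_plan_of_dual_bound {p q : ι → ℝ} (hp : p ∈ stdSimplex ℝ ι)
    (hq : q ∈ stdSimplex ℝ ι) (c : ι → ι → ℝ) (v : ℝ)
    (hv : ∀ a b : ι → ℝ, (∀ i j, a i + b j ≤ c i j) →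
      ∑ i, a i * p i + ∑ j, b j * q j ≤ v) :
    ∃ w : ι → ι → ℝ, (∀ i j, 0 ≤ w i j) ∧ (∀ i, ∑ j, w i j = p i) ∧ (∀ j, ∑ i, w i j = q j) ∧
      ∑ i, ∑ j, w i j * c i j ≤ v := by
  let T : (ι × ι → ℝ) →ₗ[ℝ] (ι → ℝ) × (ι → ℝ) × ℝ :=
    { toFun := fun w => (fun i => ∑ j, w (i, j), fun j => ∑ i, w (i, j),
        ∑ i, ∑ j, w (i, j) * c i j)
      map_add' := fun w w' => by
        ext <;> simp [Finset.sum_add_distrib, add_mul]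
      map_smul' := fun r w => by
        ext <;> simp [Finset.mul_sum, mul_assoc] }
  let S : Set ((ι → ℝ) × (ι → ℝ) × ℝ) := T '' stdSimplex ℝ (ι × ι)
  let U : Set ((ι → ℝ) × (ι → ℝ) × ℝ) := {p} ×ˢ {q} ×ˢ Set.Iic v
  have hSc : Convex ℝ S := (convex_stdSimplex ℝ _).linear_image T
  have hSk : IsCompact S := (isCompact_stdSimplex ℝ (ι × ι)).image
    (LinearMap.continuous_of_finiteDimensional T)
  have hUc : Convex ℝ U := (convex_singleton p).prod ((convex_singleton q).prod (convex_Iic v))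
  have hUk : IsClosed U := isClosed_singleton.prod (isClosed_singleton.prod isClosed_Iic)
  by_cases hdisj : Disjoint S U
  · exfalso
    obtain ⟨φ, u, u', hS, huu, hU⟩ := geometric_hahn_banach_compact_closed hSc hSk hUc hUk hdisj
    let a : ι → ℝ := fun i => φ (Pi.single i 1, 0, 0)
    let b : ι → ℝ := fun j => φ (0, Pi.single j 1, 0)
    let s : ℝ := φ (0, 0, 1)
    have hφ : ∀ x y t, φ (x, y, t) = ∑ i, x i * a i + ∑ j, y j * b j + t * s := by
      intro x y t
      have e : (x, y, t) = ∑ i, x i • ((Pi.single i 1, 0, 0) : (ι → ℝ) × (ι → ℝ) × ℝ) +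
          ∑ j, y j • ((0, Pi.single j 1, 0) : (ι → ℝ) × (ι → ℝ) × ℝ) +
          t • ((0, 0, 1) : (ι → ℝ) × (ι → ℝ) × ℝ) := by
        ext k <;> simp [Prod.fst_sum, Prod.snd_sum, Finset.sum_apply, Pi.single_apply]
      rw [e]
      simp only [map_add, map_sum, map_smul, smul_eq_mul]
      rfl
    have hUt : ∀ t ≤ v, u' < ∑ i, p i * a i + ∑ j, q j * b j + t * s := fun t ht => by
      rw [← hφ]
      exact hU _ ⟨rfl, rfl, ht⟩
    have hpq : (fun k : ι × ι => p k.1 * q k.2) ∈ stdSimplex ℝ (ι × ι) := by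
      refine ⟨fun k => mul_nonneg (hp.1 _) (hq.1 _), ?_⟩
      rw [Fintype.sum_prod_type]
      simp only [← Finset.mul_sum, hq.2, mul_one, hp.2]
    have hTpq := hS _ (Set.mem_image_of_mem T hpq)
    have e1 : T (fun k : ι × ι => p k.1 * q k.2) = (p, q, ∑ i, ∑ j, p i * q j * c i j) := by
      ext k
      · simp [T, ← Finset.mul_sum, hq.2]
      · simp [T, ← Finset.sum_mul, hp.2]
      · simp [T]
    rw [e1, hφ] at hTpq
    set t₀ := ∑ i, ∑ j, p i * q j * c i j
    have hs : s < 0 := by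
      by_contra! hs
      have h1 := hUt (min t₀ v) (min_le_right _ _)
      have h2 : min t₀ v * s ≤ t₀ * s := mul_le_mul_of_nonneg_right (min_le_left _ _) hs
      linarith
    have hdelta : ∀ i j, a i + b j + c i j * s < u := by
      intro i j
      have h := hS _ (Set.mem_image_of_mem T (single_mem_stdSimplex ℝ (i, j)))
      have e2 : T (Pi.single (i, j) 1) = (Pi.single i 1, Pi.single j 1, c i j) := by
        ext k
        · simp [T, Pi.single_apply, Prod.ext_iff, ite_and]
        · simp [T, Pi.single_apply, Prod.ext_iff, ite_and]
        · simp [T, Pi.single_apply, Prod.ext_iff, ite_and]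
      rw [e2, hφ] at h
      simpa [Pi.single_apply] using h
    have h1 := hv (fun i => (a i - u) / -s) (fun j => b j / -s) fun i j => by
      rw [← add_div, div_le_iff₀ (by linarith)]
      linarith [hdelta i j]
    have h2 : ∑ i, (a i - u) / -s * p i + ∑ j, b j / -s * q j =
        (∑ i, p i * a i + ∑ j, q j * b j - u) / -s := by
      have e3 : ∑ i, (a i - u) / -s * p i = (∑ i, p i * a i - u * ∑ i, p i) / -s := by
        rw [Finset.mul_sum, ← Finset.sum_sub_distrib, Finset.sum_div]
        exact Finset.sum_congr rfl fun i _ => by ring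
      have e4 : ∑ j, b j / -s * q j = (∑ j, q j * b j) / -s := by
        rw [Finset.sum_div]
        exact Finset.sum_congr rfl fun i _ => by ring
      rw [e3, e4, hp.2]
      ring
    rw [h2, div_le_iff₀ (by linarith)] at h1
    linarith [hUt v le_rfl]
  · obtain ⟨_, ⟨w, hw, rfl⟩, hwU⟩ := Set.not_disjoint_iff.1 hdisj
    obtain ⟨h1, h2, h3⟩ := hwU
    exact ⟨fun i j => w (i, j), fun i j => hw.1 _, fun i => congrFun h1 i,
      fun j => congrFun h2 j, h3⟩

end FiniteTransport

lemma exists_coupling_of_plan {n : ℕ} {ι : Type*} [Fintype ι]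
    {ν μ : Measure (EuclideanSpace ℝ (Fin n))}
    [IsProbabilityMeasure ν] [IsProbabilityMeasure μ] {T : EuclideanSpace ℝ (Fin n) → ι}
    (hA : ∀ i, MeasurableSet (T ⁻¹' {i})) {w : ι → ι → ℝ} (hw : ∀ i j, 0 ≤ w i j)
    (hp : ∀ i, ∑ j, w i j = ν.real (T ⁻¹' {i})) (hq : ∀ j, ∑ i, w i j = μ.real (T ⁻¹' {j})) :
    ∃ π, IsCoupling π ν μ ∧
      ∀ i j, π ((T ⁻¹' {i}) ×ˢ (T ⁻¹' {j})) = ENNReal.ofReal (w i j) := by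
  set p : ι → ℝ := fun i => ν.real (T ⁻¹' {i}) with hpdef
  set q : ι → ℝ := fun j => μ.real (T ⁻¹' {j}) with hqdef
  have hν : ∀ i, ν (T ⁻¹' {i}) = ENNReal.ofReal (p i) := fun i => by simp [hpdef]
  have hμ : ∀ j, μ (T ⁻¹' {j}) = ENNReal.ofReal (q j) := fun j => by simp [hqdef]
  have hp0 : ∀ i, 0 ≤ p i := fun i => measureReal_nonneg
  have hq0 : ∀ i, 0 ≤ q i := fun i => measureReal_nonneg
  have hwp : ∀ i j, p i = 0 → w i j = 0 := fun i j h =>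
    (Finset.sum_eq_zero_iff_of_nonneg fun j _ => hw i j).1 ((hp i).trans h) j (Finset.mem_univ j)
  have hwq : ∀ i j, q j = 0 → w i j = 0 := fun i j h =>
    (Finset.sum_eq_zero_iff_of_nonneg fun i _ => hw i j).1 ((hq j).trans h) i (Finset.mem_univ i)
  set r : ι → ι → ℝ≥0∞ := fun i j => ENNReal.ofReal (w i j / (p i * q j)) with hr
  have hrq : ∀ i j, r i j * ENNReal.ofReal (q j) = ENNReal.ofReal (w i j / p i) := fun i j => by
    rw [hr, ← ENNReal.ofReal_mul (div_nonneg (hw i j) (mul_nonneg (hp0 i) (hq0 j)))]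
    by_cases h : q j = 0
    · simp [h, hwq i j h]
    · congr 1
      rw [← div_div, div_mul_cancel₀ _ h]
  have hrp : ∀ i j, r i j * ENNReal.ofReal (p i) = ENNReal.ofReal (w i j / q j) := fun i j => by
    rw [hr, ← ENNReal.ofReal_mul (div_nonneg (hw i j) (mul_nonneg (hp0 i) (hq0 j)))]
    by_cases h : p i = 0
    · simp [h, hwp i j h]
    · congr 1
      rw [mul_comm (p i), ← div_div, div_mul_cancel₀ _ h]
  set π : Measure (EuclideanSpace ℝ (Fin n) × EuclideanSpace ℝ (Fin n)) :=
    ∑ i, ∑ j, r i j • (ν.restrict (T ⁻¹' {i})).prod (μ.restrict (T ⁻¹' {j})) with hπ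
  have hπapp : ∀ s t, MeasurableSet s → MeasurableSet t →
      π (s ×ˢ t) = ∑ i, ∑ j, r i j * (ν (s ∩ T ⁻¹' {i}) * μ (t ∩ T ⁻¹' {j})) := by
    intro s t hs ht
    simp [hπ, Measure.finsetSum_apply, Measure.prod_prod, Measure.restrict_apply hs,
      Measure.restrict_apply ht]
  refine ⟨π, ⟨?_, ?_⟩, ?_⟩
  · ext s hs
    rw [Measure.map_apply measurable_fst hs, ← Set.prod_univ, hπapp _ _ hs MeasurableSet.univ]
    have h1 : ∀ i, ∑ j, r i j * (ν (s ∩ T ⁻¹' {i}) * μ (Set.univ ∩ T ⁻¹' {j})) =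
        ν.restrict s (T ⁻¹' {i}) := by
      intro i
      rw [Measure.restrict_apply (hA i), Set.inter_comm (T ⁻¹' {i})]
      by_cases h : p i = 0
      · have : ν (s ∩ T ⁻¹' {i}) = 0 :=
          measure_mono_null Set.inter_subset_right (by rw [hν, h, ENNReal.ofReal_zero])
        simp [this]
      · have h2 : ∀ j, r i j * (ν (s ∩ T ⁻¹' {i}) * μ (Set.univ ∩ T ⁻¹' {j})) =
            ENNReal.ofReal (w i j / p i) * ν (s ∩ T ⁻¹' {i}) := fun j => by
          rw [Set.univ_inter, hμ, ← hrq]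
          ring
        simp only [h2]
        rw [← Finset.sum_mul, ← ENNReal.ofReal_sum_of_nonneg fun j _ =>
          div_nonneg (hw i j) (hp0 i), ← Finset.sum_div, hp, div_self h, ENNReal.ofReal_one,
          one_mul]
    simp only [h1]
    rw [sum_measure_preimage_singleton _ fun i _ => hA i]
    simp
  · ext s hs
    rw [Measure.map_apply measurable_snd hs, ← Set.univ_prod, hπapp _ _ MeasurableSet.univ hs,
      Finset.sum_comm]
    have h1 : ∀ j, ∑ i, r i j * (ν (Set.univ ∩ T ⁻¹' {i}) * μ (s ∩ T ⁻¹' {j})) =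
        μ.restrict s (T ⁻¹' {j}) := by
      intro j
      rw [Measure.restrict_apply (hA j), Set.inter_comm (T ⁻¹' {j})]
      by_cases h : q j = 0
      · have : μ (s ∩ T ⁻¹' {j}) = 0 :=
          measure_mono_null Set.inter_subset_right (by rw [hμ, h, ENNReal.ofReal_zero])
        simp [this]
      · have h2 : ∀ i, r i j * (ν (Set.univ ∩ T ⁻¹' {i}) * μ (s ∩ T ⁻¹' {j})) =
            ENNReal.ofReal (w i j / q j) * μ (s ∩ T ⁻¹' {j}) := fun i => by
          rw [Set.univ_inter, hν, ← hrp]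
          ring
        simp only [h2]
        rw [← Finset.sum_mul, ← ENNReal.ofReal_sum_of_nonneg fun i _ =>
          div_nonneg (hw i j) (hq0 j), ← Finset.sum_div, hq, div_self h, ENNReal.ofReal_one,
          one_mul]
    simp only [h1]
    rw [sum_measure_preimage_singleton _ fun i _ => hA i]
    simp
  · intro i j
    have hdis : ∀ k l : ι, k ≠ l → (T ⁻¹' {k}) ∩ (T ⁻¹' {l}) = ∅ := fun k l hkl => by
      rw [← Set.preimage_inter, Set.singleton_inter_eq_empty.2 (by simpa using hkl),
        Set.preimage_empty]
    rw [hπapp _ _ (hA i) (hA j), Finset.sum_eq_single i, Finset.sum_eq_single j, Set.inter_self,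
      Set.inter_self, hμ, mul_left_comm, hrq, hν, ← ENNReal.ofReal_mul (hp0 i)]
    · congr 1
      by_cases h : p i = 0
      · simp [h, hwp i j h]
      · rw [mul_div_cancel₀ _ h]
    · intro l _ hl
      simp [hdis j l hl.symm]
    · simp
    · intro k _ hk
      simp [hdis i k hk.symm]
    · simp

/-- A map with finitely many values and measurable fibres, namely the complement of a ball and
pieces of that ball that lie near a common point. -/
lemma exists_measurable_ball_partition {E : Type*} [NormedAddCommGroup E] [ProperSpace E]
    [MeasurableSpace E] [BorelSpace E] (R : ℝ) {δ : ℝ} (hδ : 0 < δ) :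
    ∃ (N : ℕ) (T : E → Option (Fin N)) (e : Fin N → E), (∀ k, MeasurableSet (T ⁻¹' {k})) ∧
      (∀ i, ‖e i‖ ≤ R) ∧ (∀ x, T x = none ↔ R < ‖x‖) ∧
      ∀ x i, T x = some i → ‖x‖ ≤ R ∧ ‖x - e i‖ ≤ δ := by
  obtain ⟨t, htR, htf, ht⟩ := (isCompact_closedBall (0 : E) R).finite_cover_balls hδ
  obtain ⟨N, e, hinj, rfl⟩ := htf.fin_param
  let A : Fin N → Set E := fun i => {x : E | ‖x‖ ≤ R} ∩ Metric.ball (e i) δ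
  have hA : ∀ i, MeasurableSet (A i) := fun i =>
    (measurableSet_le measurable_norm measurable_const).inter measurableSet_ball
  let T : E → Option (Fin N) := fun x => Fin.find? fun i => decide (x ∈ A i)
  have hnone : ∀ x, T x = none ↔ R < ‖x‖ := by
    intro x
    simp only [T, Fin.find?_eq_none_iff, decide_eq_false_iff_not]
    refine ⟨fun h => ?_, fun h i hi => (hi.1.trans_lt h).false⟩
    by_contra! hx
    obtain ⟨y, ⟨i, rfl⟩, hi⟩ := Set.mem_iUnion₂.1 (ht (mem_closedBall_zero_iff.2 hx))
    exact h i ⟨hx, hi⟩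
  have hsome : ∀ x i, T x = some i ↔ x ∈ A i ∧ ∀ j < i, x ∉ A j := by
    intro x i
    simp [T]
  refine ⟨N, T, e, ?_, fun i => mem_closedBall_zero_iff.1 (htR ⟨i, rfl⟩), hnone, fun x i hi => ?_⟩
  · rintro (_ | i)
    · have : T ⁻¹' {none} = {x | R < ‖x‖} := Set.ext hnone
      rw [this]
      exact measurableSet_lt measurable_const measurable_norm
    · have : T ⁻¹' {some i} = A i ∩ ⋂ j, ⋂ _ : j < i, (A j)ᶜ := by
        ext x
        simpa using hsome x i
      rw [this]
      exact (hA i).inter (MeasurableSet.iInter fun j => MeasurableSet.iInter fun _ => (hA j).compl)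
  · obtain ⟨h1, h2⟩ := ((hsome x i).1 hi).1
    exact ⟨h1, (mem_ball_iff_norm.1 h2).le⟩

section SecondMoment

variable {n : ℕ} {ν μ : Measure (EuclideanSpace ℝ (Fin n))}

lemma enorm_sq_le_two_mul_edist_sq_add {E : Type*} [SeminormedAddCommGroup E] (x y : E) :
    ‖y‖ₑ ^ 2 ≤ 2 * (edist x y ^ 2 + ‖x‖ₑ ^ 2) := by
  have h1 : ‖y‖ ^ 2 ≤ 2 * (dist x y ^ 2 + ‖x‖ ^ 2) := by
    have h2 := norm_le_norm_add_norm_sub x y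
    rw [dist_eq_norm]
    nlinarith [norm_nonneg y, sq_nonneg (‖x - y‖ - ‖x‖)]
  rw [edist_dist, ← ofReal_norm, ← ofReal_norm, ← ENNReal.ofReal_pow (norm_nonneg _),
    ← ENNReal.ofReal_pow (norm_nonneg _), ← ENNReal.ofReal_pow dist_nonneg,
    ← ENNReal.ofReal_add (by positivity) (by positivity), ← ENNReal.ofReal_ofNat,
    ← ENNReal.ofReal_mul (by positivity)]
  exact ENNReal.ofReal_le_ofReal h1

lemma lintegral_enorm_sq_lt_top_of_wassersteinDist_lt_top [IsProbabilityMeasure ν] {R : ℝ}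
    (hν : ∀ᵐ x ∂ν, ‖x‖ ≤ R) (h : wassersteinDist 2 ν μ ^ 2 < ∞) :
    ∫⁻ y, ‖y‖ₑ ^ 2 ∂μ < ∞ := by
  rw [wassersteinDist_two_sq] at h
  simp only [iInf_lt_iff] at h
  obtain ⟨π, ⟨h1, h2⟩, hπ⟩ := h
  have hx : ∫⁻ x, ‖x‖ₑ ^ 2 ∂ν < ∞ := by
    refine (lintegral_mono_ae (g := fun _ => ENNReal.ofReal R ^ 2) ?_).trans_lt ?_
    · filter_upwards [hν] with x hx
      rw [← ofReal_norm]
      gcongr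
    · simp
  rw [← h1, lintegral_map (by fun_prop) measurable_fst] at hx
  rw [← h2, lintegral_map (by fun_prop) measurable_snd]
  refine (lintegral_mono (g := fun q => 2 * (edist q.1 q.2 ^ 2 + ‖q.1‖ₑ ^ 2))
    fun q => enorm_sq_le_two_mul_edist_sq_add q.1 q.2).trans_lt ?_
  rw [lintegral_const_mul' _ _ (by simp), lintegral_add_right' _ (by fun_prop)]
  exact ENNReal.mul_lt_top (by simp) (ENNReal.add_lt_top.2 ⟨hπ, hx⟩)

/-- A compactly supported probability measure with finite Fisher information. -/
lemma exists_fisherInfo_lt_top [IsProbabilityMeasure μ] :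
    ∃ (ν : Measure (EuclideanSpace ℝ (Fin n))) (R : ℝ), IsProbabilityMeasure ν ∧
      (∀ᵐ x ∂ν, ‖x‖ ≤ R) ∧ fisherInfo ν μ < ∞ := by
  obtain ⟨N, hN⟩ : ∃ N : ℕ, μ (Metric.closedBall 0 N) ≠ 0 := by
    by_contra! h
    have h1 := measure_iUnion_null h
    rw [Metric.iUnion_closedBall_nat, measure_univ] at h1
    exact one_ne_zero h1
  let b : ContDiffBump (0 : EuclideanSpace ℝ (Fin n)) := ⟨N + 1, N + 2, by positivity, by linarith⟩
  have hb1 : ∀ x, |b x ^ 2| ≤ 1 := fun x => by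
    rw [abs_of_nonneg (by positivity)]
    exact pow_le_one₀ b.nonneg b.le_one
  have h_int : Integrable (fun x => b x ^ 2) μ :=
    integrable_of_continuous_of_abs_le (b.continuous.pow 2) hb1
  set Z := ∫ x, b x ^ 2 ∂μ with hZdef
  have hZ : 0 < Z := by
    rw [hZdef, integral_pos_iff_support_of_nonneg (fun x => by positivity) h_int]
    refine (pos_iff_ne_zero.2 hN).trans_le (measure_mono fun x hx => ?_)
    have : b x = 1 := b.one_of_mem_closedBall
      (Metric.closedBall_subset_closedBall (by simp [b]) hx)
    simp [this]
  have hsqrt : (fun x => Real.sqrt (b x ^ 2 / Z)) = fun x => (√Z)⁻¹ * b x := by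
    ext x
    rw [Real.sqrt_div (by positivity), Real.sqrt_sq b.nonneg, div_eq_inv_mul]
  have hbd : ContDiff ℝ 1 (fun x => (√Z)⁻¹ * b x) := contDiff_const.mul b.contDiff
  have hbs : HasCompactSupport (fun x => (√Z)⁻¹ * b x) := b.hasCompactSupport.mul_left
  obtain ⟨K, hK⟩ := (hbd.continuous_fderiv one_ne_zero).bounded_above_of_compact_support
    (hbs.fderiv ℝ)
  refine ⟨μ.withDensity fun x => ENNReal.ofReal (b x ^ 2 / Z), N + 2, ⟨?_⟩, ?_, ?_⟩
  · rw [withDensity_apply _ MeasurableSet.univ, Measure.restrict_univ,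
      ← ofReal_integral_eq_lintegral_ofReal (h_int.div_const Z)
        (Filter.Eventually.of_forall fun x => by positivity), integral_div, div_self hZ.ne',
      ENNReal.ofReal_one]
  · have hbm : Measurable fun x => ENNReal.ofReal (b x ^ 2 / Z) :=
      ((b.continuous.pow 2).div_const Z).measurable.ennreal_ofReal
    rw [ae_withDensity_iff hbm]
    refine Filter.Eventually.of_forall fun x hx => ?_
    by_contra! h
    refine hx ?_
    rw [b.zero_of_le_dist (by simpa [b] using h.le)]
    simp
  · refine (iInf₂_le (fun x => b x ^ 2 / Z) fun x => by positivity).trans_lt ?_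
    refine (iInf₂_le (by rfl) (by
      rw [hsqrt]; exact hbd.differentiable one_ne_zero)).trans_lt ?_
    rw [hsqrt]
    refine (lintegral_mono (g := fun _ => ENNReal.ofReal K ^ 2) fun x => ?_).trans_lt (by simp)
    rw [← enorm_eq_nnnorm, ← ofReal_norm, gradient, LinearIsometryEquiv.norm_map]
    exact pow_le_pow_left' (ENNReal.ofReal_le_ofReal (hK x)) 2

lemma lintegral_enorm_sq_lt_top_of_W2I [IsProbabilityMeasure μ] {C : ℝ}
    (hW2I : ∀ ν : Measure (EuclideanSpace ℝ (Fin n)), IsProbabilityMeasure ν →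
      wassersteinDist 2 ν μ ^ 2 ≤ ENNReal.ofReal (4 * C ^ 2) * fisherInfo ν μ) :
    ∫⁻ y, ‖y‖ₑ ^ 2 ∂μ < ∞ := by
  obtain ⟨ν, R, hν, hR, hI⟩ := exists_fisherInfo_lt_top (μ := μ)
  exact lintegral_enorm_sq_lt_top_of_wassersteinDist_lt_top hR
    ((hW2I ν hν).trans_lt (ENNReal.mul_lt_top ENNReal.ofReal_lt_top hI))

/-- A bound on the Hopf–Lax transform transfers second moments. -/
lemma lintegral_enorm_sq_lt_top_of_hopfLax [IsProbabilityMeasure ν] [IsProbabilityMeasure μ]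
    {B : ℝ}
    (hB : ∀ (f : EuclideanSpace ℝ (Fin n) → ℝ) (M : ℝ) (L : NNReal), (∀ x, |f x| ≤ M) →
      LipschitzWith L f → ∫ x, hopfLax f 1 x ∂ν ≤ ∫ x, f x ∂μ + B)
    (hμ : ∫⁻ y, ‖y‖ₑ ^ 2 ∂μ < ∞) : ∫⁻ x, ‖x‖ₑ ^ 2 ∂ν < ∞ := by
  have hμi : Integrable (fun y => ‖y‖ ^ 2) μ := by
    refine ⟨by fun_prop, ?_⟩
    simpa [HasFiniteIntegral] using hμ
  have hk : ∀ k : ℕ, ∫⁻ x, ENNReal.ofReal (min ‖x‖ k ^ 2) ∂ν ≤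
      ENNReal.ofReal (4 * ((∫ y, ‖y‖ ^ 2 ∂μ) / 2 + B)) := by
    intro k
    have hmin : ∀ x : EuclideanSpace ℝ (Fin n), 0 ≤ min ‖x‖ k := fun x => by positivity
    have hmk : ∀ x : EuclideanSpace ℝ (Fin n), min ‖x‖ k ≤ k := fun x => min_le_right _ _
    have hml : ∀ x y : EuclideanSpace ℝ (Fin n), |min ‖x‖ k - min ‖y‖ k| ≤ ‖x - y‖ := fun x y =>
      (abs_min_sub_min_le_max _ _ _ _).trans (by
        simpa using abs_norm_sub_norm_le x y)
    have hc : Continuous fun x : EuclideanSpace ℝ (Fin n) => min ‖x‖ (k : ℝ) ^ 2 := by fun_prop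
    have hsq : ∀ x : EuclideanSpace ℝ (Fin n), min ‖x‖ k ^ 2 ≤ (k : ℝ) ^ 2 := fun x =>
      pow_le_pow_left₀ (hmin x) (hmk x) 2
    have hM : ∀ x : EuclideanSpace ℝ (Fin n), |min ‖x‖ (k : ℝ) ^ 2 / 2| ≤ (k : ℝ) ^ 2 / 2 := fun x => by
      rw [abs_of_nonneg (by positivity)]
      linarith [hsq x]
    have hL : LipschitzWith k fun x : EuclideanSpace ℝ (Fin n) => min ‖x‖ (k : ℝ) ^ 2 / 2 := by
      refine LipschitzWith.of_dist_le_mul fun x y => ?_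
      rw [Real.dist_eq, dist_eq_norm, ← sub_div, sq_sub_sq, abs_div, abs_mul, abs_two,
        NNReal.coe_natCast, abs_of_nonneg (add_nonneg (hmin x) (hmin y)), div_le_iff₀ two_pos]
      nlinarith [hml x y, hmk x, hmk y, hmin x, hmin y, norm_nonneg (x - y),
        abs_nonneg (min ‖x‖ (k : ℝ) - min ‖y‖ k)]
    have h1 := hB _ _ _ hM hL
    have h2 : ∀ x, min ‖x‖ (k : ℝ) ^ 2 / 4 ≤
        hopfLax (fun x : EuclideanSpace ℝ (Fin n) => min ‖x‖ (k : ℝ) ^ 2 / 2) 1 x := fun x => by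
      refine le_ciInf fun y => ?_
      have := (abs_le.1 (hml x y)).2
      nlinarith [hmin x, hmin y, sq_nonneg (min ‖y‖ (k : ℝ) - ‖x - y‖), norm_nonneg (x - y)]
    have hi : ∀ ρ : Measure (EuclideanSpace ℝ (Fin n)), IsProbabilityMeasure ρ →
        Integrable (fun x => min ‖x‖ (k : ℝ) ^ 2) ρ := fun ρ _ =>
      integrable_of_continuous_of_abs_le hc fun x => (abs_of_nonneg (by positivity)).trans_le (hsq x)
    have h3 : ∫ x, min ‖x‖ (k : ℝ) ^ 2 / 4 ∂ν ≤ _ :=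
      (integral_mono ((hi ν inferInstance).div_const 4)
        (integrable_of_continuous_of_abs_le (lipschitzWith_hopfLax hM hL one_pos).continuous
          (abs_hopfLax_le hM one_pos)) h2).trans h1
    have h4 : ∫ x, min ‖x‖ (k : ℝ) ^ 2 ∂μ ≤ ∫ y, ‖y‖ ^ 2 ∂μ :=
      integral_mono (hi μ inferInstance) hμi fun x =>
        pow_le_pow_left₀ (hmin x) (min_le_left _ _) 2
    rw [integral_div, integral_div] at h3
    rw [← ofReal_integral_eq_lintegral_ofReal (hi ν inferInstance)
      (Filter.Eventually.of_forall fun x => by positivity)]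
    exact ENNReal.ofReal_le_ofReal (by linarith)
  have hsup : ∀ x : EuclideanSpace ℝ (Fin n),
      ‖x‖ₑ ^ 2 ≤ ⨆ k : ℕ, ENNReal.ofReal (min ‖x‖ k ^ 2) := fun x => by
    obtain ⟨k, hk⟩ := exists_nat_ge ‖x‖
    refine le_iSup_of_le k ?_
    rw [min_eq_left hk, ENNReal.ofReal_pow (norm_nonneg _), ofReal_norm]
  refine (lintegral_mono hsup).trans_lt ?_
  rw [lintegral_iSup (fun k => by fun_prop)]
  · exact (iSup_le hk).trans_lt ENNReal.ofReal_lt_top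
  · intro k l hkl x
    refine ENNReal.ofReal_le_ofReal (pow_le_pow_left₀ (by positivity) ?_ 2)
    gcongr

end SecondMoment

section Discretization

lemma measurable_top_of_fibers {α ι : Type*} [MeasurableSpace α] [Countable ι] {T : α → ι}
    (hT : ∀ i, MeasurableSet (T ⁻¹' {i})) : Measurable[_, ⊤] T :=
  let _ : MeasurableSpace ι := ⊤
  measurable_to_countable' hT

lemma integrable_comp_of_fibers {α ι : Type*} [MeasurableSpace α] [Fintype ι] {T : α → ι}
    (hT : ∀ i, MeasurableSet (T ⁻¹' {i})) (ρ : Measure α) [IsFiniteMeasure ρ] (a : ι → ℝ) :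
    Integrable (fun x => a (T x)) ρ :=
  let _ : MeasurableSpace ι := ⊤
  (Integrable.of_finite (f := a)).comp_measurable (measurable_top_of_fibers hT)

lemma integral_comp_of_fibers {α ι : Type*} [MeasurableSpace α] [Fintype ι] {T : α → ι}
    (hT : ∀ i, MeasurableSet (T ⁻¹' {i})) (ρ : Measure α) [IsFiniteMeasure ρ] (a : ι → ℝ) :
    ∫ x, a (T x) ∂ρ = ∑ i, a i * ρ.real (T ⁻¹' {i}) := by
  let _ : MeasurableSpace ι := ⊤
  have hTm : Measurable T := measurable_top_of_fibers hT
  rw [← integral_map (f := a) hTm.aemeasurable (by fun_prop), integral_fintype .of_finite]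
  refine Finset.sum_congr rfl fun i _ => ?_
  rw [map_measureReal_apply hTm (measurableSet_singleton i), smul_eq_mul, mul_comm]

lemma lintegral_comp_of_fibers {α ι : Type*} [MeasurableSpace α] [Fintype ι] {T : α → ι}
    (hT : ∀ i, MeasurableSet (T ⁻¹' {i})) (π : Measure (α × α)) (c : ι → ι → ℝ≥0∞) :
    ∫⁻ q, c (T q.1) (T q.2) ∂π = ∑ i, ∑ j, c i j * π ((T ⁻¹' {i}) ×ˢ (T ⁻¹' {j})) := by
  let _ : MeasurableSpace ι := ⊤
  have hTm : Measurable T := measurable_top_of_fibers hT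
  have hTT : Measurable fun q : α × α => (T q.1, T q.2) :=
    (hTm.comp measurable_fst).prodMk (hTm.comp measurable_snd)
  rw [← lintegral_map (f := fun k : ι × ι => c k.1 k.2) (measurable_of_finite _) hTT,
    lintegral_fintype, Fintype.sum_prod_type]
  refine Finset.sum_congr rfl fun i _ => Finset.sum_congr rfl fun j _ => ?_
  rw [Measure.map_apply hTT (measurableSet_singleton _), ← Set.singleton_prod_singleton]
  rfl

variable {n : ℕ} {ν μ : Measure (EuclideanSpace ℝ (Fin n))}

lemma dual_bound_of_hopfLax [IsProbabilityMeasure ν] [IsProbabilityMeasure μ] {B : ℝ}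
    (hB : ∀ (f : EuclideanSpace ℝ (Fin n) → ℝ) (M : ℝ) (L : NNReal), (∀ x, |f x| ≤ M) →
      LipschitzWith L f → ∫ x, hopfLax f 1 x ∂ν ≤ ∫ x, f x ∂μ + B)
    {ι : Type*} [Fintype ι] {T : EuclideanSpace ℝ (Fin n) → ι}
    (hT : ∀ i, MeasurableSet (T ⁻¹' {i})) {c : ι → ι → ℝ} {η K : ℝ} (hK : 0 ≤ K)
    (hc : ∀ x y, c (T x) (T y) ≤ min ‖x - y‖ K ^ 2 + η)
    {a b : ι → ℝ} (hab : ∀ i j, a i + b j ≤ c i j) :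
    ∑ i, a i * ν.real (T ⁻¹' {i}) + ∑ j, b j * μ.real (T ⁻¹' {j}) ≤ 2 * B + η := by
  obtain ⟨A, hA⟩ : ∃ A, ∀ i, |a i| ≤ A :=
    ⟨∑ i, |a i|, fun i => Finset.single_le_sum (fun i _ => abs_nonneg (a i)) (Finset.mem_univ i)⟩
  set k : EuclideanSpace ℝ (Fin n) → EuclideanSpace ℝ (Fin n) → ℝ :=
    fun x y => min ‖x - y‖ K ^ 2 with hk
  have hm0 : ∀ x y : EuclideanSpace ℝ (Fin n), 0 ≤ min ‖x - y‖ K := fun x y =>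
    le_min (norm_nonneg _) hK
  have hmK : ∀ x y : EuclideanSpace ℝ (Fin n), min ‖x - y‖ K ≤ K := fun x y => min_le_right _ _
  have hk0 : ∀ x y, 0 ≤ k x y := fun x y => sq_nonneg _
  have hkK : ∀ x y, k x y ≤ K ^ 2 := fun x y => pow_le_pow_left₀ (hm0 x y) (hmK x y) 2
  have hkL : ∀ x y z, k x y ≤ k x z + 2 * K * ‖y - z‖ := by
    intro x y z
    have h1 : min ‖x - y‖ K ≤ min ‖x - z‖ K + ‖y - z‖ := by
      have h2 : ‖x - y‖ ≤ ‖x - z‖ + ‖y - z‖ := by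
        have := norm_sub_le (x - z) (y - z)
        rwa [sub_sub_sub_cancel_right] at this
      rw [← min_add_add_right]
      exact min_le_min h2 (by linarith [norm_nonneg (y - z)])
    by_cases h3 : min ‖x - y‖ K ≤ min ‖x - z‖ K
    · have := pow_le_pow_left₀ (hm0 x y) h3 2
      have := mul_nonneg hK (norm_nonneg (y - z))
      simp only [hk]
      linarith
    · push Not at h3
      simp only [hk]
      nlinarith [hm0 x y, hm0 x z, hmK x y, hmK x z, norm_nonneg (y - z)]
  set f : EuclideanSpace ℝ (Fin n) → ℝ := fun y => ⨆ x, (a (T x) - k x y) / 2 with hf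
  have hbdd : ∀ y, BddAbove (Set.range fun x => (a (T x) - k x y) / 2) := fun y =>
    ⟨A / 2, by
      rintro _ ⟨x, rfl⟩
      have := (abs_le.1 (hA (T x))).2
      have := hk0 x y
      dsimp only
      linarith⟩
  have hle : ∀ x y, (a (T x) - k x y) / 2 ≤ f y := fun x y => le_ciSup (hbdd y) x
  have hM : ∀ y, |f y| ≤ (A + K ^ 2) / 2 := by
    refine fun y => abs_le.2 ⟨?_, ciSup_le fun x => ?_⟩
    · linarith [hle y y, (abs_le.1 (hA (T y))).1, hkK y y]
    · linarith [(abs_le.1 (hA (T x))).2, hk0 x y, sq_nonneg K]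
  have hL : LipschitzWith K.toNNReal f := LipschitzWith.of_le_add_mul _ fun y z => by
    refine ciSup_le fun x => ?_
    rw [Real.coe_toNNReal _ hK, dist_eq_norm]
    have := hkL x z y
    rw [norm_sub_rev] at this
    linarith [hle x z]
  have hlow : ∀ x, a (T x) / 2 ≤ hopfLax f 1 x := fun x => le_ciInf fun y => by
    have : k x y ≤ ‖x - y‖ ^ 2 := pow_le_pow_left₀ (hm0 x y) (min_le_left _ _) 2
    linarith [hle x y]
  have hup : ∀ y, f y ≤ (η - b (T y)) / 2 := fun y => ciSup_le fun x => by
    linarith [hab (T x) (T y), hc x y]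
  have h1 := integral_mono ((integrable_comp_of_fibers hT ν a).div_const 2)
    (integrable_of_continuous_of_abs_le (lipschitzWith_hopfLax hM hL one_pos).continuous
      (abs_hopfLax_le hM one_pos)) hlow
  have h2 := integral_mono (integrable_of_continuous_of_abs_le hL.continuous hM)
    (((integrable_const η).sub (integrable_comp_of_fibers hT μ b)).div_const 2) hup
  have h3 := hB f _ _ hM hL
  simp only [Pi.sub_apply] at h2
  rw [integral_div, integral_comp_of_fibers hT] at h1
  rw [integral_div, integral_sub (integrable_const η) (integrable_comp_of_fibers hT μ b),
    integral_comp_of_fibers hT, integral_const, probReal_univ, one_smul] at h2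
  linarith

lemma exists_lintegral_tail_le {ρ : Measure (EuclideanSpace ℝ (Fin n))}
    (h : ∫⁻ x, ‖x‖ₑ ^ 2 ∂ρ < ∞) {ε : ℝ≥0∞} (hε : 0 < ε) :
    ∃ R : ℝ, 0 < R ∧ ∫⁻ x in {x | R < ‖x‖}, ‖x‖ₑ ^ 2 ∂ρ ≤ ε := by
  set S : ℕ → Set (EuclideanSpace ℝ (Fin n)) := fun k => {x | (k : ℝ) + 1 < ‖x‖} with hS
  have hm : ∀ k, MeasurableSet (S k) := fun k => measurableSet_lt measurable_const measurable_norm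
  have hanti : Antitone S := fun k l hkl x hx => by
    have : (k : ℝ) ≤ l := by exact_mod_cast hkl
    exact (by linarith : (k : ℝ) + 1 ≤ l + 1).trans_lt hx
  have hempty : ⋂ k, S k = ∅ := by
    refine Set.eq_empty_of_forall_notMem fun x hx => ?_
    obtain ⟨k, hk⟩ := exists_nat_ge ‖x‖
    have : (k : ℝ) + 1 < ‖x‖ := Set.mem_iInter.1 hx k
    linarith
  have h1 := tendsto_measure_iInter_atTop (μ := ρ.withDensity fun x => ‖x‖ₑ ^ 2)
    (fun k => (hm k).nullMeasurableSet) hanti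
    ⟨0, ((measure_mono (Set.subset_univ _)).trans_lt
      (by rwa [withDensity_apply _ .univ, Measure.restrict_univ])).ne⟩
  rw [hempty, measure_empty] at h1
  obtain ⟨k, hk⟩ := (h1.eventually (gt_mem_nhds hε)).exists
  refine ⟨k + 1, by positivity, ?_⟩
  rw [Function.comp_apply, withDensity_apply _ (hm k)] at hk
  exact hk.le

lemma edist_sq_le_add_tails {E : Type*} [NormedAddCommGroup E] {R η : ℝ} {c : E → E → ℝ}
    (hc : ∀ x y, ‖x‖ ≤ R → ‖y‖ ≤ R → ‖x - y‖ ^ 2 ≤ c x y + η) (x y : E) :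
    edist x y ^ 2 ≤ ENNReal.ofReal (c x y) + ENNReal.ofReal η +
      4 * ({x | R < ‖x‖}.indicator (fun x => ‖x‖ₑ ^ 2) x +
        {x | R < ‖x‖}.indicator (fun x => ‖x‖ₑ ^ 2) y) := by
  have hsub := norm_sub_le x y
  have key : ∀ z : E, ‖x - y‖ ≤ 2 * ‖z‖ → edist x y ^ 2 ≤ 4 * ‖z‖ₑ ^ 2 := fun z hz => by
    rw [edist_dist, dist_eq_norm, ← ofReal_norm, ← ENNReal.ofReal_pow (norm_nonneg _),
      ← ENNReal.ofReal_pow (norm_nonneg _), ← ENNReal.ofReal_ofNat,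
      ← ENNReal.ofReal_mul (by positivity)]
    refine ENNReal.ofReal_le_ofReal ?_
    nlinarith [norm_nonneg (x - y)]
  by_cases hx : R < ‖x‖
  · by_cases hxy : ‖y‖ ≤ ‖x‖
    · refine (key x (by linarith)).trans (le_add_left ?_)
      gcongr
      rw [Set.indicator_of_mem (by exact hx)]
      exact le_self_add
    · refine (key y (by linarith)).trans (le_add_left ?_)
      gcongr
      rw [Set.indicator_of_mem (s := {x | R < ‖x‖}) (a := y) (by
        exact hx.trans (not_le.1 hxy))]
      exact le_add_self
  · by_cases hy : R < ‖y‖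
    · refine (key y (by linarith)).trans (le_add_left ?_)
      gcongr
      rw [Set.indicator_of_mem (s := {x | R < ‖x‖}) (a := y) (by exact hy)]
      exact le_add_self
    · refine le_add_right ?_
      refine le_trans ?_ ENNReal.ofReal_add_le
      rw [edist_dist, dist_eq_norm, ← ENNReal.ofReal_pow (norm_nonneg _)]
      exact ENNReal.ofReal_le_ofReal (hc x y (not_lt.1 hx) (not_lt.1 hy))

lemma IsCoupling.lintegral_edist_sq_le [IsProbabilityMeasure ν] {R η : ℝ}
    {c : EuclideanSpace ℝ (Fin n) → EuclideanSpace ℝ (Fin n) → ℝ}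
    (hc : ∀ x y, ‖x‖ ≤ R → ‖y‖ ≤ R → ‖x - y‖ ^ 2 ≤ c x y + η)
    {π : Measure (EuclideanSpace ℝ (Fin n) × EuclideanSpace ℝ (Fin n))} (hπ : IsCoupling π ν μ) :
    ∫⁻ q, edist q.1 q.2 ^ 2 ∂π ≤ ∫⁻ q, ENNReal.ofReal (c q.1 q.2) ∂π + ENNReal.ofReal η +
      4 * ∫⁻ x in {x | R < ‖x‖}, ‖x‖ₑ ^ 2 ∂(ν + μ) := by
  have hset : MeasurableSet {x : EuclideanSpace ℝ (Fin n) | R < ‖x‖} :=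
    measurableSet_lt measurable_const measurable_norm
  set g : EuclideanSpace ℝ (Fin n) → ℝ≥0∞ := {x | R < ‖x‖}.indicator fun x => ‖x‖ₑ ^ 2 with hgdef
  have hg : Measurable g := (measurable_enorm.pow_const 2).indicator hset
  have hg1 : Measurable fun q : EuclideanSpace ℝ (Fin n) × EuclideanSpace ℝ (Fin n) => g q.1 :=
    hg.comp measurable_fst
  have hg2 : Measurable fun q : EuclideanSpace ℝ (Fin n) × EuclideanSpace ℝ (Fin n) => g q.2 :=
    hg.comp measurable_snd
  have hg12 : Measurable fun q : EuclideanSpace ℝ (Fin n) × EuclideanSpace ℝ (Fin n) =>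
      g q.1 + g q.2 := hg1.add hg2
  have : IsProbabilityMeasure π := hπ.isProbabilityMeasure
  have h1 : ∫⁻ q, g q.1 ∂π = ∫⁻ x, g x ∂ν := by rw [← hπ.1, lintegral_map hg measurable_fst]
  have h2 : ∫⁻ q, g q.2 ∂π = ∫⁻ x, g x ∂μ := by rw [← hπ.2, lintegral_map hg measurable_snd]
  have h3 : ∫⁻ x in {x | R < ‖x‖}, ‖x‖ₑ ^ 2 ∂(ν + μ) = ∫⁻ q, g q.1 ∂π + ∫⁻ q, g q.2 ∂π := by
    rw [h1, h2, ← lintegral_add_measure, hgdef, lintegral_indicator hset]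
  calc ∫⁻ q, edist q.1 q.2 ^ 2 ∂π
      ≤ ∫⁻ q, (ENNReal.ofReal (c q.1 q.2) + ENNReal.ofReal η + 4 * (g q.1 + g q.2)) ∂π :=
        lintegral_mono fun q => edist_sq_le_add_tails hc q.1 q.2
    _ = _ := by
      rw [lintegral_add_right _ (hg12.const_mul 4),
        lintegral_add_right _ measurable_const, lintegral_const_mul _ hg12,
        lintegral_add_right _ hg2, lintegral_const, measure_univ, mul_one, h3]

/-- Kantorovich duality for the quadratic cost, in terms of the Hopf–Lax transform. -/
theorem wassersteinDist_sq_le_of_hopfLax [IsProbabilityMeasure ν] [IsProbabilityMeasure μ] {B : ℝ}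
    (hB : ∀ (f : EuclideanSpace ℝ (Fin n) → ℝ) (M : ℝ) (L : NNReal), (∀ x, |f x| ≤ M) →
      LipschitzWith L f → ∫ x, hopfLax f 1 x ∂ν ≤ ∫ x, f x ∂μ + B)
    (hμ : ∫⁻ y, ‖y‖ₑ ^ 2 ∂μ < ∞) :
    wassersteinDist 2 ν μ ^ 2 ≤ ENNReal.ofReal (2 * B) := by
  have hν := lintegral_enorm_sq_lt_top_of_hopfLax hB hμ
  refine ENNReal.le_of_forall_pos_le_add fun ε hε _ => ?_
  have hε' : (0 : ℝ) < ε := hε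
  obtain ⟨R, hR, htail⟩ := exists_lintegral_tail_le (ρ := ν + μ) (ε := ENNReal.ofReal (ε / 8))
    (by rw [lintegral_add_measure]; exact ENNReal.add_lt_top.2 ⟨hν, hμ⟩)
    (ENNReal.ofReal_pos.2 (by positivity))
  obtain ⟨N, T, e, hT, he, hnone, hsome⟩ := exists_measurable_ball_partition
    (E := EuclideanSpace ℝ (Fin n)) R (δ := ε / (32 * R)) (by positivity)
  have hδ : ε / (32 * R) * R = ε / 32 := by field_simp
  set δ := ε / (32 * R)
  let c : Option (Fin N) → Option (Fin N) → ℝ := fun i j =>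
    i.elim 0 fun i => j.elim 0 fun j => ‖e i - e j‖ ^ 2
  have hc0 : ∀ i j, 0 ≤ c i j := by
    rintro (_ | i) (_ | j) <;> simp [c]
  have hcball : ∀ x y, ‖x‖ ≤ R → ‖y‖ ≤ R →
      |‖x - y‖ ^ 2 - c (T x) (T y)| ≤ ε / 4 ∧ ‖x - y‖ ≤ 2 * R := by
    intro x y hx hy
    obtain ⟨i, hi⟩ := Option.ne_none_iff_exists'.1 fun h => hx.not_gt ((hnone x).1 h)
    obtain ⟨j, hj⟩ := Option.ne_none_iff_exists'.1 fun h => hy.not_gt ((hnone y).1 h)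
    have hxi := (hsome x i hi).2
    have hyj := (hsome y j hj).2
    have h1 := norm_sub_le x y
    have h2 := norm_sub_le (e i) (e j)
    have h3 : |‖x - y‖ - ‖e i - e j‖| ≤ 2 * δ := by
      refine (abs_norm_sub_norm_le _ _).trans ?_
      rw [sub_sub_sub_comm]
      exact (norm_sub_le _ _).trans (by linarith)
    have h4 : ‖x - y‖ + ‖e i - e j‖ ≤ 4 * R := by linarith [he i, he j]
    refine ⟨?_, by linarith⟩
    simp only [hi, hj, c, Option.elim_some]
    rw [sq_sub_sq, abs_mul, abs_of_nonneg (by positivity)]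
    calc _ ≤ 4 * R * (2 * δ) := by gcongr
      _ = ε / 4 := by linarith
  have hc : ∀ x y, c (T x) (T y) ≤ min ‖x - y‖ (2 * R) ^ 2 + ε / 4 := by
    intro x y
    by_cases hx : R < ‖x‖
    · simp only [(hnone x).2 hx, c, Option.elim_none]
      positivity
    by_cases hy : R < ‖y‖
    · have : c (T x) (T y) = 0 := by
        rw [(hnone y).2 hy]
        cases T x <;> simp [c]
      rw [this]
      positivity
    obtain ⟨h1, h2⟩ := hcball x y (not_lt.1 hx) (not_lt.1 hy)
    rw [min_eq_left h2]
    linarith [(abs_le.1 h1).1]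
  have hmass : ∀ ρ : Measure (EuclideanSpace ℝ (Fin n)), IsProbabilityMeasure ρ →
      (fun i => ρ.real (T ⁻¹' {i})) ∈ stdSimplex ℝ (Option (Fin N)) := fun ρ _ =>
    ⟨fun i => measureReal_nonneg, by
      simpa using (integral_comp_of_fibers hT ρ fun _ => 1).symm⟩
  obtain ⟨w, hw, hp, hq, hwc⟩ := exists_transport_plan_of_dual_bound (hmass ν inferInstance)
    (hmass μ inferInstance) c (2 * B + ε / 4)
    fun a b hab => dual_bound_of_hopfLax hB hT (by positivity) hc hab
  obtain ⟨π, hπ, hπw⟩ := exists_coupling_of_plan hT hw hp hq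
  rw [wassersteinDist_two_sq]
  refine (iInf₂_le π hπ).trans ((hπ.lintegral_edist_sq_le (R := R) (η := ε / 4)
    (c := fun x y => c (T x) (T y)) fun x y hx hy => by
      linarith [(abs_le.1 (hcball x y hx hy).1).2]).trans ?_)
  have hcost : ∑ i, ∑ j, ENNReal.ofReal (c i j) * π ((T ⁻¹' {i}) ×ˢ (T ⁻¹' {j})) =
      ENNReal.ofReal (∑ i, ∑ j, w i j * c i j) := by
    rw [ENNReal.ofReal_sum_of_nonneg fun i _ => Finset.sum_nonneg fun j _ =>
      mul_nonneg (hw i j) (hc0 i j)]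
    refine Finset.sum_congr rfl fun i _ => ?_
    rw [ENNReal.ofReal_sum_of_nonneg fun j _ => mul_nonneg (hw i j) (hc0 i j)]
    refine Finset.sum_congr rfl fun j _ => ?_
    rw [hπw, mul_comm, ENNReal.ofReal_mul (hw i j)]
  rw [lintegral_comp_of_fibers hT π fun i j => ENNReal.ofReal (c i j), hcost]
  calc _ ≤ ENNReal.ofReal (2 * B) + ENNReal.ofReal (ε / 4) + ENNReal.ofReal (ε / 4) +
        4 * ENNReal.ofReal (ε / 8) := by
        gcongr
        exact (ENNReal.ofReal_le_ofReal hwc).trans ENNReal.ofReal_add_le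
    _ = ENNReal.ofReal (2 * B) + ε := by
      rw [← ENNReal.ofReal_ofNat 4, ← ENNReal.ofReal_mul (by positivity), add_assoc, add_assoc,
        ← ENNReal.ofReal_add (by positivity) (by positivity),
        ← ENNReal.ofReal_add (by positivity) (by positivity)]
      congr 1
      rw [← ENNReal.ofReal_coe_nnreal]
      congr 1
      ring

end Discretization

/-- **W₂I(C) implies the Talagrand inequality W₂H(C)**. -/
theorem W2I_implies_W2H {n : ℕ} (V : EuclideanSpace ℝ (Fin n) → ℝ)
    (hV : ContDiff ℝ 1 V) (Z : ℝ) (hZ : 0 < Z)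
    (μ : Measure (EuclideanSpace ℝ (Fin n)))
    (hμ : μ = volume.withDensity fun x => ENNReal.ofReal (Real.exp (-V x) / Z))
    (hμprob : IsProbabilityMeasure μ)
    (C : ℝ) (hC : 0 < C)
    (hW2I : ∀ ν : Measure (EuclideanSpace ℝ (Fin n)), IsProbabilityMeasure ν →
      wassersteinDist 2 ν μ ^ 2 ≤ ENNReal.ofReal (4 * C ^ 2) * fisherInfo ν μ) :
    ∀ ν : Measure (EuclideanSpace ℝ (Fin n)), IsProbabilityMeasure ν →
      wassersteinDist 2 ν μ ^ 2 ≤ ENNReal.ofReal (2 * C) * relEntropy ν μ := by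
  intro ν hν
  rw [relEntropy]
  split_ifs with h
  · rw [← ENNReal.ofReal_mul (by positivity), mul_assoc]
    exact wassersteinDist_sq_le_of_hopfLax
      (fun f M L hM hL => integral_hopfLax_le_add_entropy hC hW2I h.1 h.2 hM hL)
      (lintegral_enorm_sq_lt_top_of_W2I hW2I)
  · rw [ENNReal.mul_top (ENNReal.ofReal_pos.2 (by positivity)).ne']
    exact le_top
end
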